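/- arXiv:1506.04546 — 3 statements merged into one kernel-verified Lean document; each statement's English description precedes it below -/
import Mathlib

section
/- If a : ℕ → ℂ is multiplicative and the Dirichlet series f(s) = Σ_{n=1}^∞ a_n n^{-s} is somewhere convergent, then the abscissa of uniform convergence and the abscissa of absolute convergence coincide: σ_a(f) = σ_b(f). -/
open Filter Topology

/-- `N`-th partial sum of the Dirichlet series `∑ a_n n^{-s}` at the point `s`. -/
noncomputable def dirichletPartial (a : ℕ → ℂ) (s : ℂ) (N : ℕ) : ℂ :=
  ∑ n ∈ Finset.range N, a (n + 1) / ((n : ℂ) + 1) ^ s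

/-- The Dirichlet series `∑ a_n n^{-σ}` converges (as a limit of partial sums). -/
def DirichletConvergesAt (a : ℕ → ℂ) (σ : ℝ) : Prop :=
  ∃ l : ℂ, Tendsto (dirichletPartial a (σ : ℂ)) atTop (𝓝 l)

/-- The series `∑ a_n n^{-σ - it}` converges uniformly in `t ∈ ℝ`. -/
def DirichletConvergesUniformlyAt (a : ℕ → ℂ) (σ : ℝ) : Prop :=
  ∃ g : ℝ → ℂ,
    TendstoUniformly (fun N (t : ℝ) => dirichletPartial a ((σ : ℂ) + (t : ℂ) * Complex.I) N) g atTop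

/-- The series `∑ |a_n| n^{-σ}` converges. -/
def DirichletAbsConvergesAt (a : ℕ → ℂ) (σ : ℝ) : Prop :=
  Summable fun n : ℕ => ‖a (n + 1)‖ / ((n : ℝ) + 1) ^ σ

/-- Abscissa of (simple) convergence. -/
noncomputable def sigmaC (a : ℕ → ℂ) : ℝ := sInf {σ : ℝ | DirichletConvergesAt a σ}

/-- Abscissa of uniform convergence. -/
noncomputable def sigmaB (a : ℕ → ℂ) : ℝ := sInf {σ : ℝ | DirichletConvergesUniformlyAt a σ}

/-- Abscissa of absolute convergence. -/
noncomputable def sigmaA (a : ℕ → ℂ) : ℝ := sInf {σ : ℝ | DirichletAbsConvergesAt a σ}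

/-- `a : ℕ → ℂ` is multiplicative: `a 1 = 1` and `a (m n) = a m * a n` for coprime `m, n ≥ 1`. -/
def IsMultiplicativeFun (a : ℕ → ℂ) : Prop :=
  a 1 = 1 ∧ ∀ m n : ℕ, 1 ≤ m → 1 ≤ n → Nat.Coprime m n → a (m * n) = a m * a n

/-- `a : ℕ → ℂ` is completely multiplicative. -/
def IsCompletelyMultiplicativeFun (a : ℕ → ℂ) : Prop :=
  a 1 = 1 ∧ ∀ m n : ℕ, 1 ≤ m → 1 ≤ n → a (m * n) = a m * a n

open scoped ComplexConjugate

/-- `F` is continuous and its averages over `[0, T]` tend to `L` as `T → ∞`. -/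
def HasMean (F : ℝ → ℂ) (L : ℂ) : Prop :=
  Continuous F ∧ Tendsto (fun T : ℝ => (T : ℂ)⁻¹ * ∫ t in (0 : ℝ)..T, F t) atTop (𝓝 L)

/-- The character `t ↦ exp (i ν t)` of the real line. -/
noncomputable def realChar (ν t : ℝ) : ℂ := Complex.exp ((ν : ℂ) * Complex.I * t)

lemma realChar_add (μ ν t : ℝ) : realChar (μ + ν) t = realChar μ t * realChar ν t := by
  rw [realChar, realChar, realChar, ← Complex.exp_add]
  push_cast
  ring_nf

lemma realChar_zero (t : ℝ) : realChar 0 t = 1 := by simp [realChar]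

lemma realChar_sum {ι : Type*} (A : Finset ι) (ν : ι → ℝ) (t : ℝ) :
    realChar (∑ i ∈ A, ν i) t = ∏ i ∈ A, realChar (ν i) t := by
  simp only [realChar, ← Complex.exp_sum]
  push_cast
  simp only [Finset.sum_mul]

lemma norm_realChar (ν t : ℝ) : ‖realChar ν t‖ = 1 := by
  rw [realChar, Complex.norm_exp]
  simp

lemma conj_realChar (ν t : ℝ) : conj (realChar ν t) = realChar (-ν) t := by
  rw [realChar, realChar, ← Complex.exp_conj]
  simp

lemma continuous_realChar (ν : ℝ) : Continuous (realChar ν) := by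
  unfold realChar
  fun_prop

lemma hasMean_realChar (ν : ℝ) : HasMean (realChar ν) (if ν = 0 then 1 else 0) := by
  refine ⟨continuous_realChar ν, ?_⟩
  split_ifs with h
  · subst h
    refine tendsto_const_nhds.congr' ?_
    filter_upwards [eventually_gt_atTop 0] with T hT
    simp only [realChar_zero, intervalIntegral.integral_const, sub_zero, Complex.real_smul, mul_one]
    rw [inv_mul_cancel₀ (by exact_mod_cast hT.ne')]
  · have hc : (ν : ℂ) * Complex.I ≠ 0 := by simp [h]
    refine squeeze_zero_norm' (a := fun T : ℝ => T⁻¹ * (2 / |ν|)) ?_ ?_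
    · filter_upwards [eventually_gt_atTop 0] with T hT
      have hint : ∫ t in (0 : ℝ)..T, realChar ν t
          = (realChar ν T - realChar ν 0) / ((ν : ℂ) * Complex.I) :=
        integral_exp_mul_complex hc
      rw [hint, norm_mul, norm_div, norm_inv, Complex.norm_real, Real.norm_of_nonneg hT.le]
      have hden : ‖(ν : ℂ) * Complex.I‖ = |ν| := by simp
      rw [hden]
      gcongr
      refine (norm_sub_le _ _).trans ?_
      rw [norm_realChar, norm_realChar]
      norm_num
    · simpa using tendsto_inv_atTop_zero.mul_const (2 / |ν|)

lemma HasMean.const_mul {F : ℝ → ℂ} {L : ℂ} (h : HasMean F L) (c : ℂ) :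
    HasMean (fun t => c * F t) (c * L) := by
  refine ⟨continuous_const.mul h.1, (h.2.const_mul c).congr fun T => ?_⟩
  rw [intervalIntegral.integral_const_mul]
  ring

lemma HasMean.sum {ι : Type*} {s : Finset ι} {F : ι → ℝ → ℂ} {L : ι → ℂ}
    (h : ∀ i ∈ s, HasMean (F i) (L i)) :
    HasMean (fun t => ∑ i ∈ s, F i t) (∑ i ∈ s, L i) := by
  refine ⟨continuous_finsetSum s fun i hi => (h i hi).1,
    (tendsto_finsetSum s fun i hi => (h i hi).2).congr fun T => ?_⟩
  rw [intervalIntegral.integral_finsetSum fun i hi => (h i hi).1.intervalIntegrable _ _,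
    Finset.mul_sum]

/-- A mean is dominated by the mean of a nonnegative majorant. -/
lemma HasMean.norm_le {F G : ℝ → ℂ} {L M : ℂ} {C : ℝ} (hF : HasMean F L) (hG : HasMean G M)
    (hG0 : ∀ t, G t = (‖G t‖ : ℂ)) (hFG : ∀ t, ‖F t‖ ≤ C * ‖G t‖) : ‖L‖ ≤ C * ‖M‖ := by
  refine le_of_tendsto_of_tendsto hF.2.norm (hG.2.norm.const_mul C) ?_
  filter_upwards [eventually_gt_atTop 0] with T hT
  have hGint : ‖∫ t in (0 : ℝ)..T, G t‖ = ∫ t in (0 : ℝ)..T, ‖G t‖ := by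
    have : ∫ t in (0 : ℝ)..T, G t = ((∫ t in (0 : ℝ)..T, ‖G t‖ : ℝ) : ℂ) := by
      rw [← intervalIntegral.integral_ofReal]
      exact intervalIntegral.integral_congr fun t _ => hG0 t
    rw [this, Complex.norm_real, Real.norm_of_nonneg]
    exact intervalIntegral.integral_nonneg hT.le fun t _ => norm_nonneg _
  rw [norm_mul, norm_mul, hGint, mul_left_comm, ← intervalIntegral.integral_const_mul]
  gcongr
  refine (intervalIntegral.norm_integral_le_integral_norm hT.le).trans ?_
  exact intervalIntegral.integral_mono_on hT.le (hF.1.norm.intervalIntegrable _ _)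
    ((hG.1.norm.const_mul C).intervalIntegrable _ _) fun t _ => hFG t

/-- The Riesz product `∏ (1 + 2 Re (w_i u_i^{it}))`. -/
noncomputable def rieszProduct {ι : Type*} (S : Finset ι) (u : ι → ℕ) (w : ι → ℂ) (t : ℝ) : ℂ :=
  ∏ i ∈ S, (w i * realChar (Real.log (u i)) t +
    (conj (w i) * realChar (-Real.log (u i)) t + 1))

lemma rieszProduct_eq_norm {ι : Type*} {S : Finset ι} (u : ι → ℕ) {w : ι → ℂ}
    (hw : ∀ i ∈ S, ‖w i‖ ≤ 1 / 2) (t : ℝ) :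
    rieszProduct S u w t = (‖rieszProduct S u w t‖ : ℂ) := by
  rw [rieszProduct, norm_prod, Complex.ofReal_prod]
  refine Finset.prod_congr rfl fun i hi => ?_
  set z := w i * realChar (Real.log (u i)) t with hz
  have hconj : conj (w i) * realChar (-Real.log (u i)) t = conj z := by
    rw [hz, map_mul, conj_realChar]
  have hnorm : ‖z‖ ≤ 1 / 2 := by
    rw [hz, norm_mul, norm_realChar, mul_one]
    exact hw i hi
  have hre : z + (conj z + 1) = ((1 + 2 * z.re : ℝ) : ℂ) := by
    rw [← add_assoc, Complex.add_conj]
    push_cast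
    ring
  have hpos : 0 ≤ 1 + 2 * z.re := by
    have := (abs_le.mp (Complex.abs_re_le_norm z)).1
    linarith
  rw [hconj, hre, Complex.norm_real, Real.norm_of_nonneg hpos]

/-- For pairwise coprime `u_i ≥ 2`, the only relations `∏_A u = n ∏_B u` with `A`, `B` disjoint
are those with `B` empty. -/
lemma prod_eq_mul_prod_iff {ι : Type*} [DecidableEq ι] {S A B : Finset ι} {u : ι → ℕ}
    (hu : ∀ i ∈ S, 2 ≤ u i) (hcop : ∀ i ∈ S, ∀ j ∈ S, i ≠ j → Nat.Coprime (u i) (u j))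
    (hA : A ⊆ S) (hB : B ⊆ S \ A) (n : ℕ) :
    ∏ i ∈ A, u i = n * ∏ i ∈ B, u i ↔ B = ∅ ∧ n = ∏ i ∈ A, u i := by
  constructor
  · intro h
    have hco : Nat.Coprime (∏ i ∈ B, u i) (∏ i ∈ A, u i) := by
      refine Nat.Coprime.prod_left fun i hi => Nat.Coprime.prod_right fun j hj => ?_
      have hi' := Finset.mem_sdiff.mp (hB hi)
      exact hcop i hi'.1 j (hA hj) fun hij => hi'.2 (hij ▸ hj)
    have hone : ∏ i ∈ B, u i = 1 := Nat.Coprime.eq_one_of_dvd hco (h ▸ dvd_mul_left _ _)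
    refine ⟨Finset.eq_empty_of_forall_notMem fun i hi => ?_, by rw [h, hone, mul_one]⟩
    have h1 : u i = 1 := Nat.dvd_one.mp (hone ▸ Finset.dvd_prod_of_mem u hi)
    have h2 := hu i (Finset.mem_sdiff.mp (hB hi)).1
    omega
  · rintro ⟨rfl, rfl⟩
    simp

lemma frequency_eq_zero_iff {ι : Type*} [DecidableEq ι] {S A B : Finset ι} {u : ι → ℕ}
    (hu : ∀ i ∈ S, 2 ≤ u i) (hcop : ∀ i ∈ S, ∀ j ∈ S, i ≠ j → Nat.Coprime (u i) (u j))
    (hA : A ⊆ S) (hB : B ⊆ S \ A) {n : ℕ} (hn : n ≠ 0) :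
    -Real.log n + (∑ i ∈ A, Real.log (u i) + ∑ i ∈ B, -Real.log (u i)) = 0 ↔
      B = ∅ ∧ n = ∏ i ∈ A, u i := by
  have huA : ∀ i ∈ A, (u i : ℝ) ≠ 0 := fun i hi => by
    have := hu i (hA hi)
    positivity
  have huB : ∀ i ∈ B, (u i : ℝ) ≠ 0 := fun i hi => by
    have := hu i (Finset.mem_sdiff.mp (hB hi)).1
    positivity
  have hA0 : 0 < ∏ i ∈ A, (u i : ℝ) := Finset.prod_pos fun i hi => by
    have := huA i hi
    positivity
  have hB0 : 0 < ∏ i ∈ B, (u i : ℝ) := Finset.prod_pos fun i hi => by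
    have := huB i hi
    positivity
  rw [← prod_eq_mul_prod_iff hu hcop hA hB, Finset.sum_neg_distrib, ← Real.log_prod huA,
    ← Real.log_prod huB, ← @Nat.cast_inj ℝ]
  push_cast
  rw [← Real.log_injOn_pos.eq_iff hA0 (show (n : ℝ) * ∏ i ∈ B, (u i : ℝ) ∈ Set.Ioi 0 by
    have : (0 : ℝ) < n := by positivity
    exact mul_pos this hB0), Real.log_mul (by exact_mod_cast hn) hB0.ne']
  constructor <;> intro h <;> linarith

lemma IsMultiplicativeFun.map_prod {ι : Type*} [DecidableEq ι] {b : ℕ → ℂ}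
    (hb : IsMultiplicativeFun b)
    {A : Finset ι} {u : ι → ℕ} (hu : ∀ i ∈ A, 1 ≤ u i)
    (hcop : ∀ i ∈ A, ∀ j ∈ A, i ≠ j → Nat.Coprime (u i) (u j)) :
    b (∏ i ∈ A, u i) = ∏ i ∈ A, b (u i) := by
  induction A using Finset.induction_on with
  | empty => simpa using hb.1
  | insert i A hi ih =>
    rw [Finset.prod_insert hi, Finset.prod_insert hi, hb.2 _ _ (hu i (by simp))
      (Nat.one_le_iff_ne_zero.mpr <| Finset.prod_ne_zero_iff.mpr fun j hj =>
        Nat.one_le_iff_ne_zero.mp (hu j (by simp [hj])))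
      (Nat.Coprime.prod_right fun j hj => hcop i (by simp) j (by simp [hj])
        fun hij => hi (hij ▸ hj)),
      ih (fun j hj => hu j (by simp [hj]))
        fun j hj k hk => hcop j (by simp [hj]) k (by simp [hk])]

lemma hasMean_mul_rieszProduct {ι : Type*} {b : ℕ → ℂ} (hb : IsMultiplicativeFun b)
    {S : Finset ι} {u : ι → ℕ} (w : ι → ℂ)
    (hu : ∀ i ∈ S, 2 ≤ u i) (hcop : ∀ i ∈ S, ∀ j ∈ S, i ≠ j → Nat.Coprime (u i) (u j))
    {N : ℕ} (hN : ∀ A ⊆ S, ∏ i ∈ A, u i ≤ N) :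
    HasMean (fun t => (∑ n ∈ Finset.range N,
        b (n + 1) * realChar (-Real.log (n + 1 : ℕ)) t) * rieszProduct S u w t)
      (∏ i ∈ S, (1 + w i * b (u i))) := by
  classical
  have hexp : ∀ t, (∑ n ∈ Finset.range N, b (n + 1) * realChar (-Real.log (n + 1 : ℕ)) t) *
      rieszProduct S u w t = ∑ A ∈ S.powerset, ∑ B ∈ (S \ A).powerset, ∑ n ∈ Finset.range N,
        (b (n + 1) * (∏ i ∈ A, w i) * ∏ i ∈ B, conj (w i)) *
          realChar (-Real.log (n + 1 : ℕ) +
            (∑ i ∈ A, Real.log (u i) + ∑ i ∈ B, -Real.log (u i))) t := by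
    intro t
    rw [rieszProduct, Finset.prod_add, Finset.mul_sum]
    refine Finset.sum_congr rfl fun A _ => ?_
    rw [Finset.prod_add_one, Finset.mul_sum, Finset.mul_sum]
    refine Finset.sum_congr rfl fun B _ => ?_
    rw [Finset.sum_mul]
    refine Finset.sum_congr rfl fun n _ => ?_
    rw [realChar_add, realChar_add, realChar_sum, realChar_sum, Finset.prod_mul_distrib,
      Finset.prod_mul_distrib]
    ring
  have hmean := HasMean.sum (s := S.powerset) fun A _ =>
    HasMean.sum (s := (S \ A).powerset) fun B _ => HasMean.sum (s := Finset.range N) fun n _ =>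
      (hasMean_realChar (-Real.log (n + 1 : ℕ) +
            (∑ i ∈ A, Real.log (u i) + ∑ i ∈ B, -Real.log (u i)))).const_mul
        (b (n + 1) * (∏ i ∈ A, w i) * ∏ i ∈ B, conj (w i))
  rw [funext hexp]
  convert hmean using 1
  rw [Finset.prod_one_add]
  refine Finset.sum_congr rfl fun A hA => ?_
  rw [Finset.mem_powerset] at hA
  have hprod : 1 ≤ ∏ i ∈ A, u i := Nat.one_le_iff_ne_zero.mpr <|
    Finset.prod_ne_zero_iff.mpr fun i hi => by
      have := hu i (hA hi)
      omega
  rw [Finset.sum_eq_single ∅, Finset.sum_eq_single (∏ i ∈ A, u i - 1)]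
  · rw [if_pos ((frequency_eq_zero_iff hu hcop hA (Finset.empty_subset _)
      (Nat.succ_ne_zero _)).mpr ⟨rfl, Nat.sub_add_cancel hprod⟩), Nat.sub_add_cancel hprod,
      hb.map_prod (fun i hi => (by norm_num : 1 ≤ 2).trans (hu i (hA hi)))
        fun i hi j hj => hcop i (hA hi) j (hA hj), Finset.prod_mul_distrib]
    simp [mul_comm]
  · intro n _ hne
    rw [if_neg, mul_zero]
    rw [frequency_eq_zero_iff hu hcop hA (Finset.empty_subset _) (Nat.succ_ne_zero _)]
    rintro ⟨-, h⟩
    omega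
  · intro h
    have := hN A hA
    exact absurd (Finset.mem_range.mpr (by omega)) h
  · intro B hB hne
    refine Finset.sum_eq_zero fun n _ => ?_
    rw [if_neg, mul_zero]
    rw [frequency_eq_zero_iff hu hcop hA (Finset.mem_powerset.mp hB) (Nat.succ_ne_zero _)]
    exact fun h => hne h.1
  · exact fun h => absurd (Finset.empty_mem_powerset _) h

lemma isMultiplicativeFun_single : IsMultiplicativeFun fun n => if n = 1 then 1 else 0 := by
  refine ⟨if_pos rfl, fun m n _ _ _ => ?_⟩
  simp only [mul_eq_one]
  split_ifs <;> simp_all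

lemma hasMean_rieszProduct {ι : Type*} {S : Finset ι} {u : ι → ℕ} (w : ι → ℂ)
    (hu : ∀ i ∈ S, 2 ≤ u i) (hcop : ∀ i ∈ S, ∀ j ∈ S, i ≠ j → Nat.Coprime (u i) (u j)) :
    HasMean (rieszProduct S u w) 1 := by
  classical
  have h := hasMean_mul_rieszProduct isMultiplicativeFun_single w hu hcop
    (N := (∑ A ∈ S.powerset, ∏ i ∈ A, u i) + 1) fun A hA =>
      (Finset.single_le_sum (f := fun A => ∏ i ∈ A, u i) (fun _ _ => Nat.zero_le _)
        (Finset.mem_powerset.mpr hA)).trans (Nat.le_succ _)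
  convert h using 1
  · funext t
    simp [realChar_zero]
  · refine (Finset.prod_eq_one fun i hi => ?_).symm
    have := hu i hi
    rw [if_neg (by omega), mul_zero, add_zero]

/-- A multiplicative function with uniformly bounded Dirichlet polynomials on the line `Re s = 0`
has bounded products `∏ (1 + |b(u_i)| / 2)` over pairwise coprime `u_i`. -/
lemma prod_one_add_half_norm_le {ι : Type*} {b : ℕ → ℂ} (hb : IsMultiplicativeFun b) {C : ℝ}
    (hC : ∀ (N : ℕ) (t : ℝ), ‖∑ n ∈ Finset.range N,
        b (n + 1) * realChar (-Real.log (n + 1 : ℕ)) t‖ ≤ C)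
    {S : Finset ι} {u : ι → ℕ}
    (hu : ∀ i ∈ S, 2 ≤ u i) (hcop : ∀ i ∈ S, ∀ j ∈ S, i ≠ j → Nat.Coprime (u i) (u j)) :
    ∏ i ∈ S, (1 + ‖b (u i)‖ / 2) ≤ C := by
  classical
  have hphase : ∀ z : ℂ, ∃ w : ℂ, ‖w‖ ≤ 1 / 2 ∧ w * z = (‖z‖ / 2 : ℝ) := by
    intro z
    rcases eq_or_ne z 0 with rfl | hz
    · exact ⟨0, by norm_num, by simp⟩
    · have hz' : (‖z‖ : ℂ) ≠ 0 := by simpa using hz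
      refine ⟨conj z / (2 * ‖z‖), ?_, ?_⟩
      · have : ‖z‖ ≠ 0 := by simpa using hz
        simp only [norm_div, norm_mul, RCLike.norm_conj, Complex.norm_real, norm_norm,
          Complex.norm_ofNat]
        exact le_of_eq (by field_simp)
      · rw [div_mul_eq_mul_div, Complex.conj_mul']
        push_cast
        field_simp
  choose w hw hwz using fun i => hphase (b (u i))
  have h := hasMean_mul_rieszProduct hb w hu hcop
    (N := ∑ A ∈ S.powerset, ∏ i ∈ A, u i) fun A hA =>
      Finset.single_le_sum (f := fun A => ∏ i ∈ A, u i) (fun _ _ => Nat.zero_le _)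
        (Finset.mem_powerset.mpr hA)
  have hle := h.norm_le (hasMean_rieszProduct w hu hcop)
    (rieszProduct_eq_norm u fun i _ => hw i) fun t => by
      rw [norm_mul]
      exact mul_le_mul_of_nonneg_right (hC _ t) (norm_nonneg _)
  rw [norm_one, mul_one, norm_prod] at hle
  refine (Finset.prod_congr rfl fun i _ => ?_).trans_le hle
  rw [hwz, ← Complex.ofReal_one, ← Complex.ofReal_add, Complex.norm_real, Real.norm_of_nonneg]
  positivity

lemma sum_le_prod_one_add {ι : Type*} (S : Finset ι) {x : ι → ℝ} (hx : ∀ i ∈ S, 0 ≤ x i) :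
    ∑ i ∈ S, x i ≤ ∏ i ∈ S, (1 + x i) := by
  classical
  suffices h : 1 + ∑ i ∈ S, x i ≤ ∏ i ∈ S, (1 + x i) by linarith
  induction S using Finset.induction_on with
  | empty => simp
  | insert i S hi ih =>
    have ih' := ih fun j hj => hx j (Finset.mem_insert_of_mem hj)
    have hxi := hx i (Finset.mem_insert_self i S)
    have hsum : 0 ≤ ∑ j ∈ S, x j :=
      Finset.sum_nonneg fun j hj => hx j (Finset.mem_insert_of_mem hj)
    rw [Finset.sum_insert hi, Finset.prod_insert hi]
    nlinarith [mul_nonneg hxi hsum, mul_le_mul_of_nonneg_left ih' (by linarith : 0 ≤ 1 + x i)]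

lemma exists_forall_le_two_mul {f : ℕ → ℝ} (hf : ∀ k, 0 ≤ f k) (hbdd : BddAbove (Set.range f)) :
    ∃ k, ∀ j, f j ≤ 2 * f k := by
  rcases (Real.iSup_nonneg hf).eq_or_lt with h0 | hpos
  · refine ⟨0, fun j => ?_⟩
    have := le_ciSup hbdd j
    linarith [hf 0]
  · obtain ⟨k, hk⟩ := exists_lt_of_lt_ciSup (half_lt_self hpos)
    refine ⟨k, fun j => ?_⟩
    have := le_ciSup hbdd j
    linarith

/-- A nonnegative multiplicative function whose values at powers of `p` are at most `β_p r^j`,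
with `r < 1` and `∑ β_p` finite, is summable. -/
lemma summable_of_primePow_le {f : ℕ → ℝ} (hf : ∀ n, 0 ≤ f n) (hf0 : f 0 = 0) (hf1 : f 1 = 1)
    (hmul : ∀ {m n : ℕ}, Nat.Coprime m n → f (m * n) = f m * f n) {r D : ℝ} (hr0 : 0 ≤ r)
    (hr1 : r < 1) {β : ℕ → ℝ} (hβ : ∀ p, 0 ≤ β p)
    (hfβ : ∀ p j : ℕ, p.Prime → f (p ^ (j + 1)) ≤ β p * r ^ j)
    (hsum : ∀ S : Finset ℕ, (∀ p ∈ S, p.Prime) → ∑ p ∈ S, β p ≤ D) : Summable f := by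
  have hgeom : Summable fun j : ℕ => r ^ j := summable_geometric_of_lt_one hr0 hr1
  have hshift : ∀ {p : ℕ}, p.Prime → Summable fun j : ℕ => f (p ^ (j + 1)) := fun {p} hp =>
    Summable.of_nonneg_of_le (fun _ => hf _) (fun j => hfβ p j hp) (hgeom.mul_left _)
  have hsumm : ∀ {p : ℕ}, p.Prime → Summable fun j : ℕ => f (p ^ j) := fun hp =>
    (summable_nat_add_iff 1).mp (hshift hp)
  have hlocal : ∀ p : ℕ, p.Prime → ∑' j : ℕ, f (p ^ j) ≤ 1 + β p * (1 - r)⁻¹ := by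
    intro p hp
    rw [(hsumm hp).tsum_eq_zero_add, pow_zero, hf1, ← tsum_geometric_of_lt_one hr0 hr1,
      ← tsum_mul_left]
    gcongr
    · exact hshift hp
    · exact hgeom.mul_left _
    · exact hfβ p _ hp
  have hR : 0 ≤ (1 - r)⁻¹ := inv_nonneg.mpr (by linarith)
  refine summable_of_sum_range_le (c := Real.exp (D * (1 - r)⁻¹)) hf fun N => ?_
  have hprod := (EulerProduct.summable_and_hasSum_smoothNumbers_prod_primesBelow_tsum hf1 hmul
    (fun hp => (hsumm hp).norm) N).2
  have hprod' := (hasSum_subtype_iff_indicator (s := N.smoothNumbers) (f := f)).mp hprod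
  calc ∑ n ∈ Finset.range N, f n
      = ∑ n ∈ Finset.range N, N.smoothNumbers.indicator f n := by
        refine Finset.sum_congr rfl fun n hn => ?_
        rcases Nat.eq_zero_or_pos n with rfl | hpos
        · simp [Set.indicator_apply, hf0]
        · rw [Set.indicator_of_mem (Nat.mem_smoothNumbers_of_lt hpos (Finset.mem_range.mp hn))]
    _ ≤ ∏ p ∈ N.primesBelow, ∑' j : ℕ, f (p ^ j) :=
        sum_le_hasSum _ (fun n _ => Set.indicator_nonneg (fun _ _ => hf _) n) hprod'
    _ ≤ ∏ p ∈ N.primesBelow, (1 + β p * (1 - r)⁻¹) :=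
        Finset.prod_le_prod (fun p _ => tsum_nonneg fun _ => hf _) fun p hp =>
          hlocal p (Nat.prime_of_mem_primesBelow hp)
    _ ≤ Real.exp (∑ p ∈ N.primesBelow, β p * (1 - r)⁻¹) :=
        Real.prod_one_add_le_exp_sum _ fun p => mul_nonneg (hβ p) hR
    _ ≤ Real.exp (D * (1 - r)⁻¹) := by
        rw [← Finset.sum_mul]
        gcongr
        exact hsum _ fun p hp => Nat.prime_of_mem_primesBelow hp

lemma summable_norm_div_rpow_of_bounded {b : ℕ → ℂ} (hb : IsMultiplicativeFun b) {C : ℝ}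
    (hC : ∀ (N : ℕ) (t : ℝ), ‖∑ n ∈ Finset.range N,
        b (n + 1) * realChar (-Real.log (n + 1 : ℕ)) t‖ ≤ C) {ε : ℝ} (hε : 0 < ε) :
    Summable fun n : ℕ => ‖b (n + 1)‖ / ((n : ℝ) + 1) ^ ε := by
  have hprod : ∀ (k : ℕ → ℕ) (S : Finset ℕ), (∀ p ∈ S, p.Prime) →
      ∑ p ∈ S, ‖b (p ^ (k p + 1))‖ / 2 ≤ C := fun k S hS =>
    (sum_le_prod_one_add S fun p _ => by positivity).trans <|
      prod_one_add_half_norm_le hb hC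
        (fun p hp => (hS p hp).two_le.trans (Nat.le_self_pow (Nat.succ_ne_zero _) p))
        fun p hp q hq hpq => Nat.coprime_pow_primes _ _ (hS p hp) (hS q hq) hpq
  have hmax : ∀ p : ℕ, ∃ k, p.Prime → ∀ j, ‖b (p ^ (j + 1))‖ ≤ 2 * ‖b (p ^ (k + 1))‖ := by
    intro p
    by_cases hp : p.Prime
    · obtain ⟨k, hk⟩ := exists_forall_le_two_mul (f := fun j => ‖b (p ^ (j + 1))‖)
        (fun _ => norm_nonneg _) ⟨2 * C, by
          rintro _ ⟨j, rfl⟩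
          have := hprod (fun _ => j) {p} (by simpa using hp)
          rw [Finset.sum_singleton] at this
          linarith⟩
      exact ⟨k, fun _ => hk⟩
    · exact ⟨0, fun h => absurd h hp⟩
  choose k hk using hmax
  let f : ℕ → ℝ := fun n => if n = 0 then 0 else ‖b n‖ / (n : ℝ) ^ ε
  have hpos : ∀ {n : ℕ}, n ≠ 0 → f n = ‖b n‖ / (n : ℝ) ^ ε := fun h => if_neg h
  have hf1 : f 1 = 1 := by simp [f, hb.1]
  have hsummable : Summable f := by
    refine summable_of_primePow_le (r := 2 ^ (-ε)) (β := fun p => 2 * ‖b (p ^ (k p + 1))‖)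
      (D := 4 * C) (fun n => ?_) (if_pos rfl) hf1 (fun {m n} hmn => ?_) (by positivity)
      (Real.rpow_lt_one_of_one_lt_of_neg one_lt_two (neg_lt_zero.mpr hε))
      (fun p => by positivity) (fun p j hp => ?_) fun S hS => ?_
    · dsimp only [f]
      split_ifs <;> positivity
    · rcases eq_or_ne m 0 with rfl | hm
      · rw [Nat.coprime_zero_left] at hmn
        rw [hmn, hf1, mul_one, mul_one]
      rcases eq_or_ne n 0 with rfl | hn
      · rw [Nat.coprime_zero_right] at hmn
        rw [hmn, hf1, one_mul, one_mul]
      rw [hpos hm, hpos hn, hpos (mul_ne_zero hm hn), hb.2 m n (Nat.one_le_iff_ne_zero.mpr hm)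
        (Nat.one_le_iff_ne_zero.mpr hn) hmn, norm_mul, Nat.cast_mul,
        Real.mul_rpow (by positivity) (by positivity), mul_div_mul_comm]
    · rw [hpos (pow_ne_zero _ hp.ne_zero), div_eq_mul_inv, ← Real.rpow_neg (by positivity)]
      have hpow : ((p ^ (j + 1) : ℕ) : ℝ) ^ (-ε) ≤ ((2 : ℝ) ^ (-ε)) ^ j := by
        rw [← Real.rpow_mul_natCast zero_le_two, mul_comm, Real.rpow_natCast_mul zero_le_two]
        refine Real.rpow_le_rpow_of_nonpos (by positivity) ?_ (by linarith)
        have h2 : 2 ^ j ≤ p ^ (j + 1) :=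
          (Nat.pow_le_pow_left hp.two_le j).trans (Nat.pow_le_pow_right hp.pos (Nat.le_succ j))
        exact_mod_cast h2
      exact mul_le_mul (hk p hp j) hpow (by positivity) (by positivity)
    · have := hprod k S hS
      rw [← Finset.sum_div] at this
      rw [← Finset.mul_sum]
      linarith
  refine ((summable_nat_add_iff 1).mpr hsummable).congr fun n => ?_
  rw [hpos (Nat.succ_ne_zero n)]
  push_cast
  rfl

lemma natCast_succ_cpow_ne_zero (n : ℕ) (s : ℂ) : ((n : ℂ) + 1) ^ s ≠ 0 := by
  rw [Complex.cpow_ne_zero_iff]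
  exact Or.inl (Nat.cast_add_one_ne_zero n)

lemma norm_natCast_succ_cpow (n : ℕ) (s : ℂ) : ‖((n : ℂ) + 1) ^ s‖ = ((n : ℝ) + 1) ^ s.re := by
  have h := Complex.norm_cpow_eq_rpow_re_of_pos (n.cast_add_one_pos (α := ℝ)) s
  simpa using h

lemma isMultiplicativeFun_div_cpow {a : ℕ → ℂ} (ha : IsMultiplicativeFun a) (s : ℂ) :
    IsMultiplicativeFun fun n => a n / (n : ℂ) ^ s := by
  refine ⟨by simp [ha.1], fun m n hm hn hmn => ?_⟩
  dsimp only
  rw [ha.2 m n hm hn hmn, Nat.cast_mul, Complex.natCast_mul_natCast_cpow, mul_div_mul_comm]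

lemma dirichletPartial_eq_sum_realChar (a : ℕ → ℂ) (s : ℂ) (t : ℝ) (N : ℕ) :
    dirichletPartial a (s + t * Complex.I) N = ∑ n ∈ Finset.range N,
      a (n + 1) / ((n + 1 : ℕ) : ℂ) ^ s * realChar (-Real.log (n + 1 : ℕ)) t := by
  refine Finset.sum_congr rfl fun n _ => ?_
  have hn : (n : ℂ) + 1 ≠ 0 := Nat.cast_add_one_ne_zero n
  rw [Complex.cpow_add _ _ hn, ← div_div, div_eq_mul_inv _ (_ ^ (_ * Complex.I)),
    ← Complex.cpow_neg, Complex.cpow_def_of_ne_zero hn (-_), realChar, Complex.ofReal_neg,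
    Complex.ofReal_log (Nat.cast_nonneg _)]
  push_cast
  ring_nf

lemma DirichletConvergesUniformlyAt.exists_bound {a : ℕ → ℂ} {σ : ℝ}
    (h : DirichletConvergesUniformlyAt a σ) :
    ∃ C : ℝ, ∀ (N : ℕ) (t : ℝ), ‖dirichletPartial a ((σ : ℂ) + t * Complex.I) N‖ ≤ C := by
  obtain ⟨g, hg⟩ := h
  obtain ⟨M, hM⟩ := eventually_atTop.mp (Metric.tendstoUniformly_iff.mp hg 1 one_pos)
  have hsmall : ∀ N ≤ M, ∀ t : ℝ, ‖dirichletPartial a ((σ : ℂ) + t * Complex.I) N‖ ≤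
      ∑ n ∈ Finset.range M, ‖a (n + 1)‖ / ((n : ℝ) + 1) ^ σ := by
    intro N hN t
    refine (norm_sum_le _ _).trans ((Finset.sum_le_sum fun n _ => ?_).trans
      (Finset.sum_le_sum_of_subset_of_nonneg (Finset.range_subset_range.mpr hN)
        fun n _ _ => by positivity))
    rw [norm_div, norm_natCast_succ_cpow]
    simp
  refine ⟨(∑ n ∈ Finset.range M, ‖a (n + 1)‖ / ((n : ℝ) + 1) ^ σ) + 2, fun N t => ?_⟩
  rcases le_total N M with hN | hN
  · linarith [hsmall N hN t]
  · have h1 := hM N hN t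
    have h2 := hM M le_rfl t
    have h3 := hsmall M le_rfl t
    have h4 := dist_triangle_left (dirichletPartial a ((σ : ℂ) + t * Complex.I) N)
      (dirichletPartial a ((σ : ℂ) + t * Complex.I) M) (g t)
    rw [dist_eq_norm] at h4
    have h5 := norm_le_norm_add_norm_sub' (dirichletPartial a ((σ : ℂ) + t * Complex.I) N)
      (dirichletPartial a ((σ : ℂ) + t * Complex.I) M)
    linarith

lemma DirichletConvergesUniformlyAt.absConvergesAt_add {a : ℕ → ℂ} (ha : IsMultiplicativeFun a)
    {σ ε : ℝ} (h : DirichletConvergesUniformlyAt a σ) (hε : 0 < ε) :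
    DirichletAbsConvergesAt a (σ + ε) := by
  obtain ⟨C, hC⟩ := h.exists_bound
  simp only [dirichletPartial_eq_sum_realChar] at hC
  refine (summable_norm_div_rpow_of_bounded (isMultiplicativeFun_div_cpow ha σ) hC hε).congr
    fun n => ?_
  rw [norm_div, Nat.cast_succ, norm_natCast_succ_cpow, Complex.ofReal_re, div_div,
    Real.rpow_add n.cast_add_one_pos]

lemma DirichletAbsConvergesAt.convergesUniformlyAt {a : ℕ → ℂ} {σ : ℝ}
    (h : DirichletAbsConvergesAt a σ) : DirichletConvergesUniformlyAt a σ := by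
  refine ⟨_, tendstoUniformly_tsum_nat h fun n t => ?_⟩
  rw [norm_div, norm_natCast_succ_cpow]
  simp

lemma DirichletConvergesAt.absConvergesAt_add_two {a : ℕ → ℂ} {σ : ℝ}
    (h : DirichletConvergesAt a σ) : DirichletAbsConvergesAt a (σ + 2) := by
  obtain ⟨l, hl⟩ := h
  have hterm : Tendsto (fun n : ℕ => a (n + 1) / ((n : ℂ) + 1) ^ (σ : ℂ)) atTop (𝓝 0) := by
    have := ((tendsto_add_atTop_iff_nat 1).mpr hl).sub hl
    rw [sub_self] at this
    refine this.congr fun n => ?_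
    rw [dirichletPartial, dirichletPartial, Finset.sum_range_succ, add_sub_cancel_left]
  obtain ⟨M, hM⟩ := hterm.norm.bddAbove_range
  have hsq : Summable fun n : ℕ => M * (1 / (((n + 1 : ℕ) : ℝ)) ^ 2) :=
    ((summable_nat_add_iff 1).mpr (Real.summable_one_div_nat_pow.mpr one_lt_two)).mul_left M
  refine hsq.of_nonneg_of_le (fun n => by positivity) fun n => ?_
  have hn := hM ⟨n, rfl⟩
  simp only [norm_div, norm_natCast_succ_cpow, Complex.ofReal_re] at hn
  rw [Real.rpow_add n.cast_add_one_pos, ← div_div, div_eq_mul_one_div, Real.rpow_two]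
  push_cast
  gcongr

lemma csInf_eq_csInf_of_subset_of_forall_add_mem {A U : Set ℝ} (hA : A.Nonempty) (hAU : A ⊆ U)
    (hUA : ∀ σ ∈ U, ∀ ε > 0, σ + ε ∈ A) : sInf A = sInf U := by
  by_cases hU : BddBelow U
  · refine le_antisymm (le_csInf (hA.mono hAU) fun σ hσ => ?_) (csInf_le_csInf hU hA hAU)
    exact le_of_forall_pos_le_add fun ε hε => csInf_le (hU.mono hAU) (hUA σ hσ ε hε)
  · have hA' : ¬BddBelow A := by
      rintro ⟨m, hm⟩
      exact hU ⟨m - 1, fun σ hσ => by linarith [hm (hUA σ hσ 1 one_pos)]⟩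
    rw [Real.sInf_of_not_bddBelow hU, Real.sInf_of_not_bddBelow hA']

/-- If `a` is multiplicative and the Dirichlet series converges somewhere,
then the abscissas of uniform and absolute convergence coincide. -/
theorem multiplicative_sigmaA_eq_sigmaB (a : ℕ → ℂ)
    (ha : IsMultiplicativeFun a) (hconv : ∃ σ : ℝ, DirichletConvergesAt a σ) :
    sigmaA a = sigmaB a := by
  obtain ⟨σ, hσ⟩ := hconv
  exact csInf_eq_csInf_of_subset_of_forall_add_mem ⟨σ + 2, hσ.absConvergesAt_add_two⟩
    (fun _ h => h.convergesUniformlyAt) fun _ h _ hε => h.absConvergesAt_add ha hε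
end

section
/- Let a : ℕ → ℂ be multiplicative and suppose that the Dirichlet series f(s) = Σ_{n=1}^∞ a_n n^{-s} converges uniformly in t ∈ ℝ at every abscissa σ ≥ 0 (i.e. σ_b(f) < 0), and set ‖f‖_∞ = sup_{Re s > 0} |f(s)| < ∞. Then for every ε > 0, Σ_{n=1}^∞ |a_n| n^{-ε} ≤ ( Π_{p prime, p^ε < 3} (1 − p^{-2ε})^{-1/2} ) · ‖f‖_∞ < ∞; in particular σ_a(f) ≤ ε for every ε > 0. -/
open Filter Topology

open Complex ComplexConjugate in
theorem tendsto_mean_exp (l : ℝ) :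
    Tendsto (fun T : ℝ => (T : ℂ)⁻¹ * ∫ t in (0 : ℝ)..T, exp (l * I * t)) atTop
      (𝓝 (if l = 0 then 1 else 0)) := by
  split_ifs with hl
  · refine tendsto_const_nhds.congr' ?_
    filter_upwards [eventually_gt_atTop 0] with T hT
    have : (T : ℂ) ≠ 0 := by exact_mod_cast hT.ne'
    simp [hl, this]
  · have hc : (l : ℂ) * I ≠ 0 := by simp [hl]
    simp_rw [integral_exp_mul_complex hc]
    have hT : Tendsto (fun T : ℝ => (2 / ‖(l : ℂ) * I‖) * T⁻¹) atTop (𝓝 0) := by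
      simpa using tendsto_inv_atTop_zero.const_mul (2 / ‖(l : ℂ) * I‖)
    refine squeeze_zero_norm' ?_ hT
    filter_upwards [eventually_gt_atTop 0] with T hT
    rw [norm_mul, norm_inv, norm_real, Real.norm_of_nonneg hT.le, norm_div, mul_comm]
    refine mul_le_mul_of_nonneg_right ?_ (inv_nonneg.2 hT.le)
    refine div_le_div_of_nonneg_right ?_ (norm_nonneg _)
    have h1 : ‖exp ((l : ℂ) * I * T)‖ = 1 := by
      rw [show (l : ℂ) * I * T = ((l * T : ℝ) : ℂ) * I by push_cast; ring]
      exact norm_exp_ofReal_mul_I _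
    refine (norm_sub_le _ _).trans ?_
    rw [h1]
    norm_num

open Complex ComplexConjugate in
theorem tendsto_mean_sum_exp {ι : Type*} (X : Finset ι) (c : ι → ℂ) (l : ι → ℝ) :
    Tendsto (fun T : ℝ => (T : ℂ)⁻¹ * ∫ t in (0 : ℝ)..T, ∑ x ∈ X, c x * exp (l x * I * t)) atTop
      (𝓝 (∑ x ∈ X, if l x = 0 then c x else 0)) := by
  have h : ∀ T : ℝ, (T : ℂ)⁻¹ * ∫ t in (0 : ℝ)..T, ∑ x ∈ X, c x * exp (l x * I * t) =
      ∑ x ∈ X, c x * ((T : ℂ)⁻¹ * ∫ t in (0 : ℝ)..T, exp (l x * I * t)) := by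
    intro T
    rw [intervalIntegral.integral_finsetSum, Finset.mul_sum]
    · refine Finset.sum_congr rfl fun x _ => ?_
      rw [intervalIntegral.integral_const_mul]
      ring
    · intro x _
      exact Continuous.intervalIntegrable (by fun_prop) _ _
  simp_rw [h]
  refine tendsto_finsetSum _ fun x _ => ?_
  simpa using (tendsto_mean_exp (l x)).const_mul (c x)

/-- The mean square of a Dirichlet polynomial with distinct frequencies. -/
theorem tendsto_mean_sq {ι : Type*} [Fintype ι] (G : ι → ℂ) (l : ι → ℝ)
    (hl : Function.Injective l) :
    Tendsto (fun T : ℝ => T⁻¹ * ∫ t in (0 : ℝ)..T, ‖∑ i, G i * Complex.exp (l i * Complex.I * t)‖ ^ 2)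
      atTop (𝓝 (∑ i, ‖G i‖ ^ 2)) := by
  classical
  have h := tendsto_mean_sum_exp (Finset.univ : Finset (ι × ι))
    (fun x => star (G x.1) * G x.2) (fun x => l x.2 - l x.1)
  have e1 : ∑ x : ι × ι, (if l x.2 - l x.1 = 0 then star (G x.1) * G x.2 else 0) =
      ((∑ i, ‖G i‖ ^ 2 : ℝ) : ℂ) := by
    rw [Fintype.sum_prod_type]
    push_cast
    refine Finset.sum_congr rfl fun i _ => ?_
    simp only [sub_eq_zero, hl.eq_iff, Finset.sum_ite_eq', Finset.mem_univ, if_true]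
    exact Complex.conj_mul' (G i)
  have e2 : ∀ t : ℝ, ∑ x : ι × ι, star (G x.1) * G x.2 *
      Complex.exp ((l x.2 - l x.1 : ℝ) * Complex.I * t) =
      ((‖∑ i, G i * Complex.exp (l i * Complex.I * t)‖ ^ 2 : ℝ) : ℂ) := by
    intro t
    push_cast
    rw [← Complex.conj_mul', map_sum, Finset.sum_mul_sum, Fintype.sum_prod_type]
    refine Finset.sum_congr rfl fun i _ => Finset.sum_congr rfl fun j _ => ?_
    rw [map_mul, ← Complex.exp_conj]
    simp only [map_mul, Complex.conj_ofReal, Complex.conj_I]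
    rw [mul_mul_mul_comm, ← Complex.exp_add]
    congr 2
    ring
  rw [e1] at h
  simp_rw [e2, intervalIntegral.integral_ofReal] at h
  have h' := (Complex.continuous_re.tendsto _).comp h
  refine h'.congr fun T => ?_
  simp only [Function.comp]
  rw [← Complex.ofReal_inv, ← Complex.ofReal_mul, Complex.ofReal_re]

/-- A bounded trigonometric polynomial acts by multiplication as a bounded form. -/
theorem norm_sum_frequency_le {ι κ : Type*} [Fintype ι] (X : Finset κ) (G H : ι → ℂ)
    (l : ι → ℝ) (hl : Function.Injective l) (b : κ → ℂ) (μ : κ → ℝ) (B : ℝ)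
    (hB : ∀ t : ℝ, ‖∑ n ∈ X, b n * Complex.exp (μ n * Complex.I * t)‖ ≤ B) :
    ‖∑ j, ∑ i, ∑ n ∈ X, if l j = l i + μ n then star (H j) * G i * b n else 0‖ ≤
      B * ((∑ j, ‖H j‖ ^ 2 + ∑ i, ‖G i‖ ^ 2) / 2) := by
  classical
  have h := tendsto_mean_sum_exp ((Finset.univ : Finset ι) ×ˢ ((Finset.univ : Finset ι) ×ˢ X))
    (fun x => star (H x.1) * G x.2.1 * b x.2.2) (fun x => l x.2.1 + μ x.2.2 - l x.1)
  simp_rw [Finset.sum_product] at h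
  have e0 : ∀ j i n, (l i + μ n - l j = 0) = (l j = l i + μ n) := fun j i n => by
    rw [sub_eq_zero, eq_comm (a := l j)]
  simp only [e0] at h
  have e2 : ∀ t : ℝ, ∑ j, ∑ i, ∑ n ∈ X, star (H j) * G i * b n *
      Complex.exp ((l i + μ n - l j : ℝ) * Complex.I * t) =
      star (∑ i, H i * Complex.exp (l i * Complex.I * t)) *
        (∑ i, G i * Complex.exp (l i * Complex.I * t)) *
        ∑ n ∈ X, b n * Complex.exp (μ n * Complex.I * t) := by
    intro t
    rw [star_sum, mul_assoc, Finset.sum_mul]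
    refine Finset.sum_congr rfl fun j _ => ?_
    rw [Finset.sum_mul, Finset.mul_sum]
    refine Finset.sum_congr rfl fun i _ => ?_
    rw [Finset.mul_sum, Finset.mul_sum]
    refine Finset.sum_congr rfl fun n _ => ?_
    have : star (H j * Complex.exp (l j * Complex.I * t)) =
        star (H j) * Complex.exp (-(l j * Complex.I * t)) := by
      rw [star_mul', ← starRingEnd_apply (Complex.exp _), ← Complex.exp_conj]
      simp
    rw [this, show ((l i + μ n - l j : ℝ) * Complex.I * t : ℂ) =
      -(l j * Complex.I * t) + (l i * Complex.I * t + μ n * Complex.I * t) by push_cast; ring,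
      Complex.exp_add, Complex.exp_add]
    ring
  simp_rw [e2] at h
  have hr := (((tendsto_mean_sq H l hl).add (tendsto_mean_sq G l hl)).div_const 2).const_mul B
  refine le_of_tendsto_of_tendsto h.norm hr ?_
  filter_upwards [eventually_gt_atTop 0] with T hT
  rw [norm_mul, norm_inv, Complex.norm_real, Real.norm_of_nonneg hT.le, ← mul_add, mul_div_assoc,
    mul_left_comm]
  refine mul_le_mul_of_nonneg_left ?_ (inv_nonneg.2 hT.le)
  rw [← intervalIntegral.integral_add
    (Continuous.intervalIntegrable (by fun_prop) _ _)
    (Continuous.intervalIntegrable (by fun_prop) _ _), ← intervalIntegral.integral_div,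
    ← intervalIntegral.integral_const_mul]
  refine intervalIntegral.norm_integral_le_of_norm_le hT.le ?_
    (Continuous.intervalIntegrable (by fun_prop) _ _)
  refine Filter.Eventually.of_forall fun t _ => ?_
  rw [norm_mul, norm_mul, norm_star, mul_comm]
  have hB0 : 0 ≤ B := (norm_nonneg _).trans (hB t)
  set x := ‖∑ i, H i * Complex.exp (l i * Complex.I * t)‖
  set y := ‖∑ i, G i * Complex.exp (l i * Complex.I * t)‖
  refine mul_le_mul (hB t) ?_ (by positivity) hB0
  nlinarith [sq_nonneg (x - y)]

theorem dirichletPartial_vertical (a : ℕ → ℂ) (σ t : ℝ) (N : ℕ) :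
    dirichletPartial a ((σ : ℂ) + (t : ℂ) * Complex.I) N =
      ∑ n ∈ Finset.range N, (a (n + 1) * (((n + 1 : ℕ) : ℝ) ^ (-σ) : ℝ)) *
        Complex.exp ((-Real.log (n + 1 : ℕ) : ℝ) * Complex.I * t) := by
  refine Finset.sum_congr rfl fun n _ => ?_
  have h0 : ((n + 1 : ℕ) : ℂ) ≠ 0 := by exact_mod_cast n.succ_ne_zero
  have h1 : ((n : ℂ) + 1) = ((n + 1 : ℕ) : ℂ) := by push_cast; ring
  rw [h1, div_eq_mul_inv, ← Complex.cpow_neg, neg_add, Complex.cpow_add _ _ h0, mul_assoc,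
    Complex.ofReal_cpow (Nat.cast_nonneg _), Complex.ofReal_natCast, Complex.ofReal_neg]
  congr 2
  rw [Complex.cpow_def_of_ne_zero h0, Complex.ofReal_neg, ← Complex.natCast_log]
  congr 1
  ring

/-- Multiplication by a Dirichlet series bounded by `M` on the right half plane is a form bounded
by `M` on Dirichlet polynomials. -/
theorem norm_sum_dvd_le {a : ℕ → ℂ} {F : ℂ → ℂ} {M : ℝ}
    (hu : ∀ σ : ℝ, 0 ≤ σ → DirichletConvergesUniformlyAt a σ)
    (hF : ∀ s : ℂ, 0 < s.re → Tendsto (dirichletPartial a s) atTop (𝓝 (F s)))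
    (hM : ∀ s : ℂ, 0 < s.re → ‖F s‖ ≤ M)
    {ι : Type*} [Fintype ι] (d : ι → ℕ) (hd : Function.Injective d) (hpos : ∀ i, 0 < d i)
    (G H : ι → ℂ) :
    ‖∑ j, ∑ i, if d i ∣ d j then star (H j) * G i * a (d j / d i) else 0‖ ≤
      M * ((∑ j, ‖H j‖ ^ 2 + ∑ i, ‖G i‖ ^ 2) / 2) := by
  classical
  have key : ∀ η : ℝ, 0 < η →
      ‖∑ j, ∑ i, if d i ∣ d j then
        star (H j) * G i * (a (d j / d i) * (((d j / d i : ℕ) : ℝ) ^ (-η) : ℝ)) else 0‖ ≤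
      (M + η) * ((∑ j, ‖H j‖ ^ 2 + ∑ i, ‖G i‖ ^ 2) / 2) := by
    intro η hη
    obtain ⟨g, hg⟩ := hu η hη.le
    have hgF : ∀ t : ℝ, g t = F ((η : ℂ) + (t : ℂ) * Complex.I) := fun t =>
      tendsto_nhds_unique (hg.tendsto_at t) (hF _ (by simpa using hη))
    obtain ⟨N, hN, hNd⟩ := ((Metric.tendstoUniformly_iff.1 hg η hη).and
      (eventually_ge_atTop (∑ j, d j))).exists
    have hB : ∀ t : ℝ, ‖∑ n ∈ Finset.range N, (a (n + 1) * (((n + 1 : ℕ) : ℝ) ^ (-η) : ℝ)) *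
        Complex.exp ((-Real.log (n + 1 : ℕ) : ℝ) * Complex.I * t)‖ ≤ M + η := by
      intro t
      rw [← dirichletPartial_vertical]
      have h1 := hN t
      have h2 := hM ((η : ℂ) + (t : ℂ) * Complex.I) (by simpa using hη)
      rw [hgF, dist_comm, dist_eq_norm] at h1
      have h3 := norm_le_norm_add_norm_sub'
        (dirichletPartial a ((η : ℂ) + (t : ℂ) * Complex.I) N) (F ((η : ℂ) + (t : ℂ) * Complex.I))
      linarith
    have hl : Function.Injective fun i => -Real.log (d i) := by
      intro i j hij
      apply hd
      have := Real.log_injOn_pos (Set.mem_Ioi.2 (Nat.cast_pos.2 (hpos i)))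
        (Set.mem_Ioi.2 (Nat.cast_pos.2 (hpos j))) (neg_injective hij)
      exact_mod_cast this
    refine le_of_eq_of_le (congrArg _ ?_) (norm_sum_frequency_le (Finset.range N) G H
      (fun i => -Real.log (d i)) hl _ (fun n => -Real.log (n + 1 : ℕ)) (M + η) hB)
    refine Finset.sum_congr rfl fun j _ => Finset.sum_congr rfl fun i _ => ?_
    have hiff : ∀ n : ℕ, (-Real.log (d j) = -Real.log (d i) + -Real.log (n + 1 : ℕ)) ↔
        d j = d i * (n + 1) := by
      intro n
      have hi : (0 : ℝ) < d i := Nat.cast_pos.2 (hpos i)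
      have hn : (0 : ℝ) < (n + 1 : ℕ) := Nat.cast_pos.2 n.succ_pos
      rw [← neg_add, neg_inj, ← Real.log_mul hi.ne' hn.ne',
        Real.log_injOn_pos.eq_iff (Set.mem_Ioi.2 (Nat.cast_pos.2 (hpos j)))
          (Set.mem_Ioi.2 (mul_pos hi hn))]
      exact_mod_cast Iff.rfl
    simp only [hiff]
    split_ifs with hdvd
    · obtain ⟨m, hm⟩ := hdvd
      have hm0 : m ≠ 0 := by
        rintro rfl
        exact (hpos j).ne' (by simpa using hm)
      obtain ⟨m, rfl⟩ := Nat.exists_eq_succ_of_ne_zero hm0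
      have hmN : m ∈ Finset.range N := by
        have h1 : d j ≤ ∑ j, d j :=
          Finset.single_le_sum (f := d) (fun _ _ => Nat.zero_le _) (Finset.mem_univ j)
        have h2 : m + 1 ≤ d j := by
          rw [hm]
          exact Nat.le_mul_of_pos_left _ (hpos i)
        exact Finset.mem_range.2 (by omega)
      have hdiv : d j / d i = m + 1 := by
        rw [hm, Nat.succ_eq_add_one, Nat.mul_div_cancel_left _ (hpos i)]
      rw [Finset.sum_eq_single_of_mem m hmN, if_pos hm, hdiv]
      intro n _ hnm
      rw [if_neg]
      intro hn
      exact hnm (by simpa using Nat.eq_of_mul_eq_mul_left (hpos i) (hn.symm.trans hm))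
    · refine (Finset.sum_eq_zero fun n _ => if_neg fun hn => hdvd ⟨_, hn⟩).symm
  have hlim : Tendsto (fun η : ℝ => ‖∑ j, ∑ i, if d i ∣ d j then
        star (H j) * G i * (a (d j / d i) * (((d j / d i : ℕ) : ℝ) ^ (-η) : ℝ)) else 0‖)
      (𝓝[>] 0) (𝓝 ‖∑ j, ∑ i, if d i ∣ d j then star (H j) * G i * a (d j / d i) else 0‖) := by
    refine Tendsto.norm (tendsto_finsetSum _ fun j _ => tendsto_finsetSum _ fun i _ => ?_)
    split_ifs with hdvd
    · have hq : (((d j / d i : ℕ) : ℝ)) ≠ 0 :=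
        Nat.cast_ne_zero.2 (Nat.div_pos (Nat.le_of_dvd (hpos j) hdvd) (hpos i)).ne'
      have hc : Continuous fun η : ℝ =>
          star (H j) * G i * (a (d j / d i) * (((d j / d i : ℕ) : ℝ) ^ (-η) : ℝ)) := by
        have := (Real.continuous_const_rpow hq).comp continuous_neg
        exact continuous_const.mul (continuous_const.mul (Complex.continuous_ofReal.comp this))
      have := hc.tendsto 0
      simp only [neg_zero, Real.rpow_zero, Complex.ofReal_one, mul_one] at this
      exact this.mono_left nhdsWithin_le_nhds
    · exact tendsto_const_nhds
  have hlim2 : Tendsto (fun η : ℝ => (M + η) * ((∑ j, ‖H j‖ ^ 2 + ∑ i, ‖G i‖ ^ 2) / 2))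
      (𝓝[>] 0) (𝓝 (M * ((∑ j, ‖H j‖ ^ 2 + ∑ i, ‖G i‖ ^ 2) / 2))) := by
    have hc : Continuous fun η : ℝ => (M + η) * ((∑ j, ‖H j‖ ^ 2 + ∑ i, ‖G i‖ ^ 2) / 2) := by
      fun_prop
    have := hc.tendsto 0
    rw [add_zero] at this
    exact this.mono_left nhdsWithin_le_nhds
  refine le_of_tendsto_of_tendsto hlim hlim2 ?_
  filter_upwards [self_mem_nhdsWithin] with η hη using key η hη

/-- The lower triangular Toeplitz matrix of a sequence. -/
def toeplitz (c : ℕ → ℂ) (m : ℕ) : Matrix (Fin m) (Fin m) ℂ :=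
  fun l k => if k ≤ l then c (l - k) else 0

/-- A unit lower triangular Toeplitz matrix attains its norm `A`, and its entries are controlled
by `A`. -/
theorem exists_toeplitz_extremal (c : ℕ → ℂ) (hc : c 0 = 1) {m : ℕ} (hm : 0 < m) :
    ∃ (A : ℝ) (g h : Fin m → ℂ), 1 ≤ A ∧ ∑ k, ‖g k‖ ^ 2 = 1 ∧ ∑ l, ‖h l‖ ^ 2 = 1 ∧
      ∑ l, ∑ k, star (h l) * g k * toeplitz c m l k = A ∧
      ∑ k : Fin m, ‖c k‖ ^ 2 ≤ A ^ 2 ∧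
      ∀ k : Fin m, (k : ℕ) ≠ 0 → ‖c k‖ * A ≤ A ^ 2 - 1 := by
  classical
  have : NeZero m := ⟨hm.ne'⟩
  set T := Matrix.toEuclideanCLM (𝕜 := ℂ) (toeplitz c m) with hT
  have hTapp : ∀ (x : EuclideanSpace ℂ (Fin m)) l, T x l = ∑ k, toeplitz c m l k * x k := by
    intro x l
    rfl
  obtain ⟨g, hg, hmax⟩ := (isCompact_sphere (0 : EuclideanSpace ℂ (Fin m)) 1).exists_isMaxOn
    ⟨EuclideanSpace.single 0 1, by simp⟩ (f := fun x => ‖T x‖) (by fun_prop)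
  have hg1 : ‖g‖ = 1 := by simpa using hg
  set A := ‖T g‖ with hA
  have hbound : ∀ x, ‖T x‖ ≤ A * ‖x‖ := by
    intro x
    rcases eq_or_ne x 0 with rfl | hx
    · simp
    · have hx' : ‖x‖ ≠ 0 := norm_ne_zero_iff.2 hx
      have := hmax (show ((‖x‖⁻¹ : ℝ) : ℂ) • x ∈ Metric.sphere (0 : EuclideanSpace ℂ (Fin m)) 1 by
        simp [norm_smul, hx'])
      simp only [Set.mem_ofPred_eq, map_smul, norm_smul, Complex.norm_real, norm_inv, norm_norm]
        at this
      rwa [inv_mul_le_iff₀ (by positivity), mul_comm] at this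
  have hsq : ∀ x, ∑ l, ‖T x l‖ ^ 2 ≤ A ^ 2 * ∑ l, ‖x l‖ ^ 2 := by
    intro x
    rw [← EuclideanSpace.norm_sq_eq, ← EuclideanSpace.norm_sq_eq, ← mul_pow]
    exact pow_le_pow_left₀ (norm_nonneg _) (hbound x) 2
  have hcol : ∑ k : Fin m, ‖c k‖ ^ 2 ≤ A ^ 2 := by
    have := hsq (EuclideanSpace.single 0 1)
    simpa [hTapp, toeplitz, Pi.single_apply, apply_ite] using this
  have hA0 : 0 ≤ A := norm_nonneg _
  have hA1 : 1 ≤ A := by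
    have h1 : ‖c (0 : Fin m)‖ ^ 2 ≤ ∑ k : Fin m, ‖c k‖ ^ 2 :=
      Finset.single_le_sum (f := fun k : Fin m => ‖c k‖ ^ 2) (fun _ _ => by positivity)
        (Finset.mem_univ _)
    simp only [Fin.val_zero, hc, norm_one, one_pow] at h1
    nlinarith
  refine ⟨A, g, fun l => ((A⁻¹ : ℝ) : ℂ) * T g l, hA1, ?_, ?_, ?_, hcol, ?_⟩
  · rw [← EuclideanSpace.norm_sq_eq, hg1, one_pow]
  · simp_rw [norm_mul, mul_pow]
    rw [← Finset.mul_sum, ← EuclideanSpace.norm_sq_eq, Complex.norm_real, ← mul_pow, ← hA,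
      Real.norm_of_nonneg (by positivity), inv_mul_cancel₀ (by positivity), one_pow]
  · have : ∀ l, ∑ k, star (((A⁻¹ : ℝ) : ℂ) * T g l) * g k * toeplitz c m l k =
        ((A⁻¹ * ‖T g l‖ ^ 2 : ℝ) : ℂ) := by
      intro l
      simp_rw [mul_assoc, mul_comm (g _)]
      rw [← Finset.mul_sum, ← hTapp, star_mul', mul_assoc, Complex.ofReal_mul]
      congr 1
      · exact Complex.conj_ofReal _
      · rw [← starRingEnd_apply, Complex.conj_mul', Complex.ofReal_pow]
    simp_rw [this]
    rw [← Complex.ofReal_sum, ← Finset.mul_sum, ← EuclideanSpace.norm_sq_eq, ← hA]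
    congr 1
    field_simp
  · intro k hk
    have hk0 : k ≠ 0 := fun h => hk (by simp [h])
    have hy : ∀ y : ℂ, 1 + ‖c k + y‖ ^ 2 ≤ A ^ 2 * (1 + ‖y‖ ^ 2) := by
      intro y
      set x : EuclideanSpace ℂ (Fin m) := EuclideanSpace.single 0 1 + EuclideanSpace.single k y
      have hx := hsq x
      have h0 : T x 0 = 1 := by
        simp [hTapp, x, toeplitz, hc, hk0]
      have h1 : T x k = c k + y := by
        simp [hTapp, x, toeplitz, hc]
      have h2 : ∑ l, ‖x l‖ ^ 2 = 1 + ‖y‖ ^ 2 := by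
        rw [← Finset.sum_subset (Finset.subset_univ {0, k}), Finset.sum_pair hk0.symm]
        · simp [x, hk0, hk0.symm]
        · intro l _ hl
          simp only [Finset.mem_insert, Finset.mem_singleton, not_or] at hl
          simp [x, hl.1, hl.2]
      have h3 : ‖T x 0‖ ^ 2 + ‖T x k‖ ^ 2 ≤ ∑ l, ‖T x l‖ ^ 2 := by
        rw [← Finset.sum_pair (f := fun l => ‖T x l‖ ^ 2) hk0.symm]
        exact Finset.sum_le_sum_of_subset_of_nonneg (Finset.subset_univ _)
          fun _ _ _ => by positivity
      rw [h0, h1, norm_one, one_pow] at h3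
      rw [h2] at hx
      exact h3.trans hx
    have hr : ∀ r : ℝ, 1 + ((1 + r) * ‖c k‖) ^ 2 ≤ A ^ 2 * (1 + (r * ‖c k‖) ^ 2) := by
      intro r
      have := hy (r * c k)
      rwa [show c k + r * c k = ((1 + r : ℝ) : ℂ) * c k by push_cast; ring, norm_mul, norm_mul,
        Complex.norm_real, Complex.norm_real, mul_pow, mul_pow, Real.norm_eq_abs, Real.norm_eq_abs,
        sq_abs, sq_abs, ← mul_pow, ← mul_pow] at this
    set α := ‖c k‖
    have hα : 0 ≤ α := norm_nonneg _
    rcases hA1.eq_or_lt with h | h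
    · have := hr 1
      rw [← h] at this ⊢
      nlinarith
    · have hD : 0 < A ^ 2 - 1 := by nlinarith
      have := hr (A ^ 2 - 1)⁻¹
      refine abs_le_of_sq_le_sq' ?_ hD.le |>.2
      set D := A ^ 2 - 1
      have hA2 : A ^ 2 = D + 1 := by ring
      rw [mul_pow, hA2]
      rw [hA2] at this
      field_simp at this
      nlinarith

/-- The Bohr and Cauchy-Schwarz bounds for a sequence controlled by `A`. -/
theorem sum_mul_pow_le {c : ℕ → ℂ} (hc : c 0 = 1) {m : ℕ} {A r : ℝ} (hA : 1 ≤ A)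
    (hsq : ∑ k : Fin m, ‖c k‖ ^ 2 ≤ A ^ 2)
    (hk : ∀ k : Fin m, (k : ℕ) ≠ 0 → ‖c k‖ * A ≤ A ^ 2 - 1) (hr0 : 0 < r) (hr1 : r < 1) :
    ∑ k : Fin m, ‖c k‖ * r ^ (k : ℕ) ≤
      (if 1 / 3 < r then (1 - r ^ 2) ^ (-(1 / 2) : ℝ) else 1) * A := by
  have hA0 : 0 < A := by linarith
  have hgeom : ∀ (q : ℝ), 0 ≤ q → q < 1 → ∀ n : ℕ, ∑ k ∈ Finset.range n, q ^ k ≤ (1 - q)⁻¹ := by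
    intro q h0 h1 n
    rw [← tsum_geometric_of_lt_one h0 h1]
    exact (summable_geometric_of_lt_one h0 h1).sum_le_tsum _ fun _ _ => by positivity
  split_ifs with h
  · have hr2 : 0 < 1 - r ^ 2 := by nlinarith
    refine abs_le_of_sq_le_sq' ?_ (by positivity) |>.2
    have h1 : ∑ k : Fin m, (r ^ (k : ℕ)) ^ 2 ≤ (1 - r ^ 2)⁻¹ := by
      simp_rw [← pow_mul, mul_comm _ 2, pow_mul]
      rw [Fin.sum_univ_eq_sum_range (fun k => (r ^ 2) ^ k)]
      exact hgeom _ (by positivity) (by nlinarith) m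
    calc (∑ k : Fin m, ‖c k‖ * r ^ (k : ℕ)) ^ 2
        ≤ (∑ k : Fin m, ‖c k‖ ^ 2) * ∑ k : Fin m, (r ^ (k : ℕ)) ^ 2 :=
          Finset.sum_mul_sq_le_sq_mul_sq _ _ _
      _ ≤ A ^ 2 * (1 - r ^ 2)⁻¹ := by gcongr
      _ = _ := by
        rw [mul_pow, ← Real.rpow_natCast (_ ^ _ : ℝ) 2, ← Real.rpow_mul hr2.le]
        norm_num [Real.rpow_neg_one, mul_comm]
  · rw [one_mul]
    cases m with
    | zero => simpa using hA0.le
    | succ n =>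
      rw [Fin.sum_univ_succ]
      have h1 : ∀ k : Fin n, ‖c k.succ‖ * r ^ (k.succ : ℕ) ≤ (A - A⁻¹) * r * r ^ (k : ℕ) := by
        intro k
        have := hk k.succ (by simp)
        have h2 : ‖c k.succ‖ ≤ A - A⁻¹ := by
          rw [← mul_le_mul_iff_left₀ hA0, sub_mul, inv_mul_cancel₀ hA0.ne']
          nlinarith
        rw [Fin.val_succ, pow_succ', mul_assoc]
        exact mul_le_mul_of_nonneg_right h2 (by positivity)
      have hAinv : 0 ≤ A - A⁻¹ := by
        have := inv_le_one_of_one_le₀ hA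
        linarith
      have h2 : ∑ k : Fin n, ‖c k.succ‖ * r ^ (k.succ : ℕ) ≤ (A - A⁻¹) * (1 / 2) := by
        refine (Finset.sum_le_sum fun k _ => h1 k).trans ?_
        rw [← Finset.mul_sum, mul_assoc, Fin.sum_univ_eq_sum_range (fun k => r ^ k)]
        refine mul_le_mul_of_nonneg_left ?_ hAinv
        refine (mul_le_mul_of_nonneg_left (hgeom r hr0.le hr1 n) hr0.le).trans ?_
        rw [← div_eq_mul_inv, div_le_iff₀ (by linarith)]
        linarith
      have h3 : 0 ≤ A * (A - 2 + A⁻¹) := by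
        have : A * (A - 2 + A⁻¹) = (A - 1) ^ 2 := by field_simp; ring
        rw [this]
        positivity
      have h4 := nonneg_of_mul_nonneg_right h3 hA0
      simp only [Fin.val_zero, hc, norm_one, pow_zero, mul_one]
      linarith

theorem IsMultiplicativeFun.map_prod_pow {a : ℕ → ℂ} (ha : IsMultiplicativeFun a) {ι : Type*}
    (s : Finset ι) {p : ι → ℕ} (hinj : Function.Injective p) (hp : ∀ i, (p i).Prime) (e : ι → ℕ) :
    a (∏ i ∈ s, p i ^ e i) = ∏ i ∈ s, a (p i ^ e i) := by
  classical
  induction s using Finset.induction_on with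
  | empty => simpa using ha.1
  | insert i s hi ih =>
    rw [Finset.prod_insert hi, Finset.prod_insert hi, ha.2, ih]
    · exact Nat.pos_of_ne_zero (pow_ne_zero _ (hp i).ne_zero)
    · exact Nat.pos_of_ne_zero (Finset.prod_ne_zero_iff.2 fun j _ => pow_ne_zero _ (hp j).ne_zero)
    · refine Nat.Coprime.prod_right fun j hj => Nat.Coprime.pow _ _ ?_
      exact (Nat.coprime_primes (hp i) (hp j)).2 fun h => hi (hinj h ▸ hj)

theorem factorization_prod_pow_apply {ι : Type*} [Fintype ι] {p : ι → ℕ}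
    (hinj : Function.Injective p) (hp : ∀ i, (p i).Prime) (e : ι → ℕ) (i : ι) :
    (∏ j, p j ^ e j).factorization (p i) = e i := by
  classical
  rw [Nat.factorization_prod fun j _ => pow_ne_zero _ (hp j).ne_zero]
  simp [(hp _).factorization, Finsupp.single_apply, hinj.eq_iff]

theorem prod_pow_dvd_prod_pow_iff {ι : Type*} [Fintype ι] {p : ι → ℕ}
    (hinj : Function.Injective p) (hp : ∀ i, (p i).Prime) (e f : ι → ℕ) :
    ∏ j, p j ^ e j ∣ ∏ j, p j ^ f j ↔ ∀ i, e i ≤ f i := by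
  refine ⟨fun h i => ?_, fun h => Finset.prod_dvd_prod_of_dvd _ _ fun i _ => pow_dvd_pow _ (h i)⟩
  have h0 : ∀ e : ι → ℕ, ∏ j, p j ^ e j ≠ 0 := fun e =>
    Finset.prod_ne_zero_iff.2 fun j _ => pow_ne_zero _ (hp j).ne_zero
  have := (Nat.factorization_le_iff_dvd (h0 e) (h0 f)).2 h (p i)
  rwa [factorization_prod_pow_apply hinj hp, factorization_prod_pow_apply hinj hp] at this

/-- The product of the Toeplitz forms attached to the local factors is bounded by `M`. -/
theorem norm_prod_toeplitz_le {a : ℕ → ℂ} (ha : IsMultiplicativeFun a) {F : ℂ → ℂ} {M : ℝ}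
    (hu : ∀ σ : ℝ, 0 ≤ σ → DirichletConvergesUniformlyAt a σ)
    (hF : ∀ s : ℂ, 0 < s.re → Tendsto (dirichletPartial a s) atTop (𝓝 (F s)))
    (hM : ∀ s : ℂ, 0 < s.re → ‖F s‖ ≤ M)
    {ι : Type*} [Fintype ι] {p : ι → ℕ} (hinj : Function.Injective p) (hp : ∀ i, (p i).Prime)
    {m : ℕ} (g h : ι → Fin m → ℂ) (hg : ∀ i, ∑ k, ‖g i k‖ ^ 2 = 1)
    (hh : ∀ i, ∑ k, ‖h i k‖ ^ 2 = 1) :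
    ‖∏ i, ∑ l, ∑ k, star (h i l) * g i k * toeplitz (fun n => a (p i ^ n)) m l k‖ ≤ M := by
  classical
  have hd : Function.Injective fun k : ι → Fin m => ∏ i, p i ^ (k i : ℕ) := by
    intro k l hkl
    funext i
    have := congrArg (fun n => n.factorization (p i)) hkl
    simp only [factorization_prod_pow_apply hinj hp (fun i => (k i : ℕ)),
      factorization_prod_pow_apply hinj hp (fun i => (l i : ℕ))] at this
    exact Fin.ext this
  have hpos : ∀ k : ι → Fin m, 0 < ∏ i, p i ^ (k i : ℕ) := fun k =>
    Finset.prod_pos fun i _ => pow_pos (hp i).pos _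
  have hunit : ∀ g : ι → Fin m → ℂ, (∀ i, ∑ k, ‖g i k‖ ^ 2 = 1) →
      ∑ k : ι → Fin m, ‖∏ i, g i (k i)‖ ^ 2 = 1 := by
    intro g hg
    simp_rw [norm_prod, ← Finset.prod_pow]
    rw [← Fintype.piFinset_univ,
      ← Finset.prod_univ_sum (fun _ => Finset.univ) (fun i k => ‖g i k‖ ^ 2)]
    simp [hg]
  have key := norm_sum_dvd_le hu hF hM _ hd hpos (fun k => ∏ i, g i (k i)) (fun k => ∏ i, h i (k i))
  rw [hunit g hg, hunit h hh] at key
  norm_num only [mul_one] at key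
  refine le_of_eq_of_le (congrArg _ ?_) key
  rw [Finset.prod_univ_sum, Fintype.piFinset_univ]
  refine Finset.sum_congr rfl fun l _ => ?_
  rw [Finset.prod_univ_sum, Fintype.piFinset_univ]
  refine Finset.sum_congr rfl fun k _ => ?_
  rw [Finset.prod_mul_distrib, Finset.prod_mul_distrib, star_prod]
  split_ifs with hdvd
  · have hle := (prod_pow_dvd_prod_pow_iff hinj hp (fun i => (k i : ℕ)) (fun i => (l i : ℕ))).1 hdvd
    have hdiv : (∏ i, p i ^ (l i : ℕ)) / ∏ i, p i ^ (k i : ℕ) = ∏ i, p i ^ ((l i : ℕ) - k i) := by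
      refine Nat.div_eq_of_eq_mul_left (hpos k) ?_
      rw [← Finset.prod_mul_distrib]
      exact Finset.prod_congr rfl fun i _ => by rw [← pow_add, Nat.sub_add_cancel (hle i)]
    rw [hdiv, ha.map_prod_pow _ hinj hp]
    congr 1
    exact Finset.prod_congr rfl fun i _ => if_pos (hle i)
  · have hnle := fun hle => hdvd
      ((prod_pow_dvd_prod_pow_iff hinj hp (fun i => (k i : ℕ)) (fun i => (l i : ℕ))).2 hle)
    obtain ⟨i, hi⟩ := not_forall.1 hnle
    have hz : toeplitz (fun n => a (p i ^ n)) m (l i) (k i) = 0 := if_neg hi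
    rw [Finset.prod_eq_zero (f := fun i => toeplitz (fun n => a (p i ^ n)) m (l i) (k i))
      (Finset.mem_univ i) hz, mul_zero]

/-- The absolute local sums at finitely many primes, with `M` and the Bohr constants. -/
theorem prod_local_sum_le {a : ℕ → ℂ} (ha : IsMultiplicativeFun a) {F : ℂ → ℂ} {M : ℝ}
    (hu : ∀ σ : ℝ, 0 ≤ σ → DirichletConvergesUniformlyAt a σ)
    (hF : ∀ s : ℂ, 0 < s.re → Tendsto (dirichletPartial a s) atTop (𝓝 (F s)))
    (hM : ∀ s : ℂ, 0 < s.re → ‖F s‖ ≤ M)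
    {ι : Type*} [Fintype ι] {p : ι → ℕ} (hinj : Function.Injective p) (hp : ∀ i, (p i).Prime)
    {m : ℕ} (hm : 0 < m) (r : ι → ℝ) (hr0 : ∀ i, 0 < r i) (hr1 : ∀ i, r i < 1) :
    ∏ i, ∑ k : Fin m, ‖a (p i ^ (k : ℕ))‖ * r i ^ (k : ℕ) ≤
      (∏ i, if 1 / 3 < r i then (1 - r i ^ 2) ^ (-(1 / 2) : ℝ) else 1) * M := by
  have hc : ∀ i, a (p i ^ 0) = 1 := fun i => by rw [pow_zero, ha.1]
  choose A g h hA hg hh hAeq hsq hk using fun i =>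
    exists_toeplitz_extremal (fun n => a (p i ^ n)) (hc i) hm
  have hprod : ∏ i, A i ≤ M := by
    have := norm_prod_toeplitz_le ha hu hF hM hinj hp g h hg hh
    simp_rw [hAeq] at this
    rw [← Complex.ofReal_prod, Complex.norm_real] at this
    exact (le_abs_self _).trans this
  calc ∏ i, ∑ k : Fin m, ‖a (p i ^ (k : ℕ))‖ * r i ^ (k : ℕ)
      ≤ ∏ i, (if 1 / 3 < r i then (1 - r i ^ 2) ^ (-(1 / 2) : ℝ) else 1) * A i := by
        refine Finset.prod_le_prod (fun i _ => Finset.sum_nonneg fun k _ => ?_) fun i _ => ?_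
        · have := hr0 i
          positivity
        · exact sum_mul_pow_le (c := fun n => a (p i ^ n)) (hc i) (hA i) (hsq i) (hk i)
            (hr0 i) (hr1 i)
    _ ≤ _ := by
        rw [Finset.prod_mul_distrib]
        refine mul_le_mul_of_nonneg_left hprod (Finset.prod_nonneg fun i _ => ?_)
        have h1 := hr0 i
        have h2 := hr1 i
        split_ifs
        · exact Real.rpow_nonneg (by nlinarith) _
        · exact zero_le_one

/-- Truncated absolute sums are dominated by a finite Euler product. -/
theorem sum_range_le_prod_local_sum {a : ℕ → ℂ} (ha : IsMultiplicativeFun a) (ε : ℝ) {N L : ℕ}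
    (hNL : N < L) :
    ∑ n ∈ Finset.range N, ‖a (n + 1)‖ / ((n : ℝ) + 1) ^ ε ≤
      ∏ p : {p // p ∈ L.primesBelow}, ∑ k : Fin L, ‖a ((p : ℕ) ^ (k : ℕ))‖ *
        (((p : ℕ) : ℝ) ^ (-ε)) ^ (k : ℕ) := by
  classical
  rw [Finset.prod_univ_sum, Fintype.piFinset_univ]
  have hp : ∀ p : {p // p ∈ L.primesBelow}, (p : ℕ).Prime := fun p =>
    Nat.prime_of_mem_primesBelow p.2
  let d : ({p // p ∈ L.primesBelow} → Fin L) → ℕ := fun k =>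
    ∏ p : {p // p ∈ L.primesBelow}, (p : ℕ) ^ (k p : ℕ)
  have hterm : ∀ k : {p // p ∈ L.primesBelow} → Fin L,
      ∏ p : {p // p ∈ L.primesBelow}, ‖a ((p : ℕ) ^ (k p : ℕ))‖ * (((p : ℕ) : ℝ) ^ (-ε)) ^ (k p : ℕ) =
      ‖a (d k)‖ * (d k : ℝ) ^ (-ε) := by
    intro k
    simp only [d]
    rw [ha.map_prod_pow _ Subtype.val_injective hp (fun p => (k p : ℕ)), norm_prod,
      Finset.prod_mul_distrib]
    congr 1
    push_cast
    rw [← Real.finsetProd_rpow _ _ fun _ _ => by positivity]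
    refine Finset.prod_congr rfl fun p _ => ?_
    rw [← Real.rpow_natCast, ← Real.rpow_natCast, ← Real.rpow_mul (by positivity),
      ← Real.rpow_mul (by positivity), mul_comm]
  simp_rw [hterm]
  have : NeZero L := ⟨by omega⟩
  let e : ℕ → {p // p ∈ L.primesBelow} → Fin L := fun n p =>
    Fin.ofNat L ((n + 1).factorization p)
  have hde : ∀ n ∈ Finset.range N, d (e n) = n + 1 := by
    intro n hn
    have hn' := Finset.mem_range.1 hn
    have hlt : ∀ p, (n + 1).factorization p < L := fun p =>
      (Nat.factorization_lt p n.succ_ne_zero).trans_le (by omega)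
    simp only [d, e, Fin.val_ofNat, Nat.mod_eq_of_lt (hlt _)]
    rw [Finset.prod_coe_sort L.primesBelow fun p => p ^ (n + 1).factorization p]
    refine Eq.trans ?_ (Nat.prod_factorization_pow_eq_self n.succ_ne_zero)
    refine (Finsupp.prod_of_support_subset _ ?_ _ fun _ _ => pow_zero _).symm
    intro p hp
    rw [Nat.support_factorization] at hp
    refine Nat.mem_primesBelow.2 ⟨?_, Nat.prime_of_mem_primeFactors hp⟩
    exact (Nat.le_of_mem_primeFactors hp).trans_lt (by omega)
  have hinj : Set.InjOn e (Finset.range N) := by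
    intro x hx y hy hxy
    have := hde x hx
    rw [hxy, hde y hy] at this
    omega
  calc ∑ n ∈ Finset.range N, ‖a (n + 1)‖ / ((n : ℝ) + 1) ^ ε
      = ∑ n ∈ Finset.range N, ‖a (d (e n))‖ * (d (e n) : ℝ) ^ (-ε) := by
        refine Finset.sum_congr rfl fun n hn => ?_
        rw [hde n hn, Real.rpow_neg (by positivity), div_eq_mul_inv, Nat.cast_add_one]
    _ = ∑ k ∈ (Finset.range N).image e, ‖a (d k)‖ * (d k : ℝ) ^ (-ε) :=
        (Finset.sum_image (f := fun k => ‖a (d k)‖ * (d k : ℝ) ^ (-ε)) hinj).symm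
    _ ≤ _ := Finset.sum_le_sum_of_subset_of_nonneg (Finset.subset_univ _)
        fun k _ _ => by positivity

theorem one_third_lt_rpow_neg_iff {p ε : ℝ} (hp : 0 < p) : 1 / 3 < p ^ (-ε) ↔ p ^ ε < 3 := by
  rw [Real.rpow_neg hp.le, one_div, inv_lt_inv₀ (by norm_num) (Real.rpow_pos_of_pos hp _)]

theorem lt_of_rpow_lt_three {p L : ℕ} {ε : ℝ} (hε : 0 < ε) (hL : (3 : ℝ) ^ ε⁻¹ ≤ L)
    (h : (p : ℝ) ^ ε < 3) : p < L := by
  have h1 : (p : ℝ) < 3 ^ ε⁻¹ := by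
    rwa [Real.lt_rpow_inv_iff_of_pos (Nat.cast_nonneg _) (by norm_num) hε]
  exact_mod_cast h1.trans_le hL

theorem prod_local_const_eq_finprod {ε : ℝ} (hε : 0 < ε) {L : ℕ} (hL : (3 : ℝ) ^ ε⁻¹ ≤ L) :
    (∏ p : {p // p ∈ L.primesBelow}, if 1 / 3 < (((p : ℕ) : ℝ) ^ (-ε)) then
      (1 - (((p : ℕ) : ℝ) ^ (-ε)) ^ 2) ^ (-(1 / 2) : ℝ) else 1) =
    ∏ᶠ (p : ℕ) (_ : p.Prime ∧ (p : ℝ) ^ ε < 3),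
      (1 - (p : ℝ) ^ (-(2 * ε))) ^ (-(1 / 2) : ℝ) := by
  classical
  rw [Finset.prod_coe_sort L.primesBelow fun p : ℕ => if 1 / 3 < ((p : ℝ) ^ (-ε)) then
      (1 - ((p : ℝ) ^ (-ε)) ^ 2) ^ (-(1 / 2) : ℝ) else 1, ← Finset.prod_filter]
  rw [finprod_cond_eq_prod_of_cond_iff (fun p : ℕ => (1 - (p : ℝ) ^ (-(2 * ε))) ^ (-(1 / 2) : ℝ))
    (p := fun p : ℕ => p.Prime ∧ (p : ℝ) ^ ε < 3) (t := L.primesBelow.filter fun p : ℕ =>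
    1 / 3 < ((p : ℝ) ^ (-ε)))]
  · refine Finset.prod_congr rfl fun p _ => ?_
    rw [← Real.rpow_natCast, ← Real.rpow_mul (Nat.cast_nonneg _)]
    congr 3
    push_cast
    ring
  · intro p _
    rw [Finset.mem_filter, Nat.mem_primesBelow]
    refine ⟨fun h => ⟨⟨lt_of_rpow_lt_three hε hL h.2, h.1⟩, ?_⟩, fun h => ⟨h.1.2, ?_⟩⟩
    · exact (one_third_lt_rpow_neg_iff (Nat.cast_pos.2 h.1.pos)).2 h.2
    · exact (one_third_lt_rpow_neg_iff (Nat.cast_pos.2 h.1.2.pos)).1 h.2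

/-- If `a` is multiplicative, the Dirichlet series converges uniformly in
`t` at every abscissa `σ ≥ 0` with limit function `F` and `M = sup_{Re s > 0} |F(s)|`,
then for every `ε > 0`,
`∑ |a_n| n^{-ε} ≤ (∏_{p prime, p^ε < 3} (1 - p^{-2ε})^{-1/2}) * M < ∞`. -/
theorem multiplicative_uniform_to_absolute_bound (a : ℕ → ℂ)
    (ha : IsMultiplicativeFun a) (F : ℂ → ℂ) (M : ℝ)
    (hu : ∀ σ : ℝ, 0 ≤ σ → DirichletConvergesUniformlyAt a σ)
    (hF : ∀ s : ℂ, 0 < s.re → Tendsto (dirichletPartial a s) atTop (𝓝 (F s)))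
    (hM : IsLUB ((fun s : ℂ => ‖F s‖) '' {s : ℂ | 0 < s.re}) M)
    (ε : ℝ) (hε : 0 < ε) :
    DirichletAbsConvergesAt a ε ∧
      ∑' n : ℕ, ‖a (n + 1)‖ / ((n : ℝ) + 1) ^ ε ≤
        (∏ᶠ (p : ℕ) (_ : p.Prime ∧ (p : ℝ) ^ ε < 3),
          (1 - (p : ℝ) ^ (-(2 * ε))) ^ (-(1 / 2) : ℝ)) * M := by
  have hMb : ∀ s : ℂ, 0 < s.re → ‖F s‖ ≤ M := fun s hs => hM.1 ⟨s, hs, rfl⟩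
  have hbound : ∀ N : ℕ, ∑ n ∈ Finset.range N, ‖a (n + 1)‖ / ((n : ℝ) + 1) ^ ε ≤
      (∏ᶠ (p : ℕ) (_ : p.Prime ∧ (p : ℝ) ^ ε < 3),
        (1 - (p : ℝ) ^ (-(2 * ε))) ^ (-(1 / 2) : ℝ)) * M := by
    intro N
    obtain ⟨L₀, hL₀⟩ := exists_nat_ge ((3 : ℝ) ^ ε⁻¹)
    have hL : (3 : ℝ) ^ ε⁻¹ ≤ (N + 1 + L₀ : ℕ) := hL₀.trans (by exact_mod_cast Nat.le_add_left _ _)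
    rw [← prod_local_const_eq_finprod hε hL]
    have hp : ∀ p : {p // p ∈ (N + 1 + L₀).primesBelow}, (p : ℕ).Prime := fun p =>
      Nat.prime_of_mem_primesBelow p.2
    refine (sum_range_le_prod_local_sum ha ε (by omega)).trans
      (prod_local_sum_le ha hu hF hMb Subtype.val_injective hp (by omega)
        (fun p => ((p : ℕ) : ℝ) ^ (-ε)) (fun p => ?_) fun p => ?_)
    · exact Real.rpow_pos_of_pos (Nat.cast_pos.2 (hp p).pos) _
    · exact Real.rpow_lt_one_of_one_lt_of_neg (Nat.one_lt_cast.2 (hp p).one_lt) (neg_neg_of_pos hε)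
  have hnn : ∀ n : ℕ, 0 ≤ ‖a (n + 1)‖ / ((n : ℝ) + 1) ^ ε := fun n => by positivity
  exact ⟨summable_of_sum_range_le hnn hbound, Real.tsum_le_of_sum_range_le hnn hbound⟩
end

section
/- Let a : ℕ → ℂ be multiplicative with Σ_{n=1}^∞ |a_n| < ∞, let f(s) = Σ_{n=1}^∞ a_n n^{-s}, and for each prime p let f_p(s) = 1 + Σ_{k=1}^∞ a_{p^k} p^{-ks}. Then sup_{Re s > 0} |f(s)| = Π_{p prime} sup_{Re s > 0} |f_p(s)| (the product being a possibly infinite product of numbers each ≥ 1, converging to a finite value). -/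
open Filter Topology

/-- A subgroup of a finite-dimensional torus on which no nontrivial character is trivial is
dense. -/
theorem UnitAddTorus.dense_of_forall_mFourier_ne_one {ι : Type*} [Fintype ι]
    (S : AddSubgroup (UnitAddTorus ι))
    (hS : ∀ n : ι → ℤ, n ≠ 0 → ∃ x ∈ S, UnitAddTorus.mFourier n x ≠ 1) :
    Dense (S : Set (UnitAddTorus ι)) := by
  have hinv : ∀ h ∈ S, ∀ x : UnitAddTorus ι, Metric.infDist (x + h) S = Metric.infDist x S := by
    intro h hh x
    have key := Metric.infDist_image (IsometryEquiv.addRight h).isometry (x := x) (t := (S : Set _))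
    have himage : (IsometryEquiv.addRight h) '' (S : Set (UnitAddTorus ι)) = S := by
      ext y
      constructor
      · rintro ⟨z, hz, rfl⟩
        exact S.add_mem hz hh
      · intro hy
        exact ⟨y - h, S.sub_mem hy hh, by simp⟩
    rwa [himage] at key
  let φ : C(UnitAddTorus ι, ℂ) :=
    ⟨fun x => (Metric.infDist x (S : Set (UnitAddTorus ι)) : ℂ),
      Complex.continuous_ofReal.comp (Metric.continuous_infDist_pt _)⟩
  have hcoeff : ∀ n : ι → ℤ, n ≠ 0 → UnitAddTorus.mFourierCoeff φ n = 0 := by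
    intro n hn
    obtain ⟨h, hh, hne⟩ := hS (-n) (neg_ne_zero.mpr hn)
    have htrans : UnitAddTorus.mFourierCoeff φ n =
        UnitAddTorus.mFourier (-n) h * UnitAddTorus.mFourierCoeff φ n := by
      let μ : MeasureTheory.Measure (UnitAddTorus ι) :=
        MeasureTheory.Measure.pi fun _ => AddCircle.haarAddCircle
      change ∫ t, UnitAddTorus.mFourier (-n) t • φ t ∂μ =
        UnitAddTorus.mFourier (-n) h * ∫ t, UnitAddTorus.mFourier (-n) t • φ t ∂μ
      refine (MeasureTheory.integral_add_right_eq_self (μ := μ)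
        (fun t => UnitAddTorus.mFourier (-n) t • φ t) h).symm.trans ?_
      rw [← MeasureTheory.integral_const_mul]
      congr 1 with t
      have h1 : φ (t + h) = φ t := congrArg Complex.ofReal (hinv h hh t)
      have h2 : UnitAddTorus.mFourier (-n) (t + h) =
          UnitAddTorus.mFourier (-n) t * UnitAddTorus.mFourier (-n) h := by
        simp [UnitAddTorus.mFourier, Finset.prod_mul_distrib, -fourier_apply, fourier_apply,
          AddCircle.toCircle_add, smul_add]
      rw [h1, h2, smul_eq_mul, smul_eq_mul]
      ring
    by_contra h0
    exact hne (mul_right_cancel₀ h0 (by rw [one_mul, ← htrans]))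
  have hsummable : Summable (UnitAddTorus.mFourierCoeff φ) :=
    summable_of_ne_finset_zero (s := {0}) fun n hn => hcoeff n (by simpa using hn)
  have hconst : ∀ x, φ x = UnitAddTorus.mFourierCoeff φ 0 := by
    intro x
    refine (UnitAddTorus.hasSum_mFourier_series_apply_of_summable hsummable x).unique ?_
    convert hasSum_single (0 : ι → ℤ) ?_ using 1
    · simp [UnitAddTorus.mFourier_zero]
    · intro n hn
      simp [hcoeff n hn]
  have hzero : φ 0 = 0 := by
    simp [φ, Metric.infDist_zero_of_mem (s := (S : Set (UnitAddTorus ι))) S.zero_mem]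
  intro x
  rw [Metric.mem_closure_iff_infDist_zero ⟨0, S.zero_mem⟩]
  have hx : φ x = 0 := by rw [hconst, ← hconst 0, hzero]
  exact Complex.ofReal_eq_zero.mp hx

/-- **Kronecker's approximation theorem**: a line whose slopes are linearly independent over the
integers is dense in the torus. -/
theorem UnitAddTorus.denseRange_line {ι : Type*} [Fintype ι] (θ : ι → ℝ)
    (hθ : ∀ n : ι → ℤ, ∑ i, n i * θ i = 0 → n = 0) :
    DenseRange (fun (t : ℝ) (i : ι) => ((t * θ i : ℝ) : UnitAddCircle)) := by
  let γ : ℝ →+ UnitAddTorus ι :=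
    { toFun := fun t i => ((t * θ i : ℝ) : UnitAddCircle)
      map_zero' := by ext i; simp
      map_add' := fun s t => by
        ext i
        rw [add_mul, AddCircle.coe_add]
        rfl }
  refine UnitAddTorus.dense_of_forall_mFourier_ne_one γ.range fun n hn => ?_
  set L := ∑ i, n i * θ i with hL
  have hL0 : L ≠ 0 := fun h => hn (hθ n h)
  refine ⟨γ (1 / (2 * L)), ⟨_, rfl⟩, ?_⟩
  have : UnitAddTorus.mFourier n (γ (1 / (2 * L))) = Complex.exp (Real.pi * Complex.I) := by
    have hsum : (Real.pi : ℂ) * Complex.I =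
        ∑ i, 2 * Real.pi * Complex.I * n i * ((1 / (2 * L) * θ i : ℝ) : ℂ) := by
      have hL0' : (L : ℂ) ≠ 0 := by exact_mod_cast hL0
      have : ∑ i, 2 * Real.pi * Complex.I * n i * ((1 / (2 * L) * θ i : ℝ) : ℂ) =
          Real.pi * Complex.I / L * L := by
        conv_rhs => enter [2]; rw [hL]
        push_cast
        rw [Finset.mul_sum]
        refine Finset.sum_congr rfl fun i _ => ?_
        field_simp
      rw [this]
      field_simp
    rw [hsum, Complex.exp_sum]
    refine Finset.prod_congr rfl fun i _ => ?_
    exact (fourier_coe_apply (T := 1)).trans (by simp)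
  rw [this, Complex.exp_pi_mul_I]
  norm_num

/-- The logarithms of distinct primes are linearly independent over the integers. -/
theorem Nat.Primes.eq_zero_of_sum_mul_log_eq_zero {S : Finset Nat.Primes} (n : S → ℤ)
    (h : ∑ p, n p * Real.log (p : Nat.Primes) = 0) : n = 0 := by
  let N (m : S → ℕ) : ℕ := ∏ p : S, ((p : Nat.Primes) : ℕ) ^ m p
  have hpos (m : S → ℕ) : N m ≠ 0 :=
    Finset.prod_ne_zero_iff.mpr fun p _ => pow_ne_zero _ p.1.2.ne_zero
  have hlog (m : S → ℕ) : Real.log (N m) = ∑ p : S, m p * Real.log (p : Nat.Primes) := by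
    simp only [N]
    push_cast
    rw [Real.log_prod fun p _ => pow_ne_zero _ (by exact_mod_cast p.1.2.ne_zero)]
    simp [Real.log_pow]
  have hfac (m : S → ℕ) (q : S) : (N m).factorization ((q : Nat.Primes) : ℕ) = m q := by
    rw [Nat.factorization_prod fun p _ => pow_ne_zero _ p.1.2.ne_zero, Finsupp.finsetSum_apply,
      Finset.sum_eq_single q]
    · simp [q.1.2.factorization_self]
    · intro p _ hpq
      have : ((p : Nat.Primes) : ℕ) ≠ (q : Nat.Primes) :=
        fun h => hpq (Subtype.ext (Subtype.ext h))
      simp [p.1.2.factorization, this]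
    · simp
  have hN : N (fun p => (n p).toNat) = N (fun p => (-n p).toNat) := by
    have : Real.log (N fun p => (n p).toNat) = Real.log (N fun p => (-n p).toNat) := by
      rw [hlog, hlog, ← sub_eq_zero, ← Finset.sum_sub_distrib, ← h]
      refine Finset.sum_congr rfl fun p _ => ?_
      have : (((n p).toNat : ℤ) : ℝ) - (((-n p).toNat : ℤ) : ℝ) = n p := by
        exact_mod_cast Int.toNat_sub_toNat_neg (n p)
      rw [← sub_mul, ← this]
      push_cast
      ring
    exact_mod_cast Real.log_injOn_pos (Set.mem_Ioi.mpr (by exact_mod_cast (hpos _).bot_lt))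
      (Set.mem_Ioi.mpr (by exact_mod_cast (hpos _).bot_lt)) this
  ext q
  have := hfac (fun p => (n p).toNat) q
  rw [hN, hfac] at this
  simp only [Pi.zero_apply]
  omega

section PowerSeries

variable {b : ℕ → ℂ}

theorem norm_mul_pow_le_of_norm_le_one {z : ℂ} (hz : ‖z‖ ≤ 1) (c : ℂ) (k : ℕ) :
    ‖c * z ^ k‖ ≤ ‖c‖ := by
  rw [norm_mul, norm_pow]
  exact mul_le_of_le_one_right (norm_nonneg _) (pow_le_one₀ (norm_nonneg _) hz)

theorem continuousOn_tsum_mul_pow (hb : Summable fun k => ‖b k‖) :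
    ContinuousOn (fun z : ℂ => ∑' k, b k * z ^ k) (Metric.closedBall 0 1) :=
  continuousOn_tsum (fun k => by fun_prop) hb fun k z hz =>
    norm_mul_pow_le_of_norm_le_one (by simpa using hz) _ k

/-- An absolutely convergent power series on the closed unit disc attains its maximum modulus on
the unit circle. -/
theorem exists_norm_eq_one_forall_norm_tsum_mul_pow_le (hb : Summable fun k => ‖b k‖) :
    ∃ w : ℂ, ‖w‖ = 1 ∧ ∀ z : ℂ, ‖z‖ ≤ 1 → ‖∑' k, b k * z ^ k‖ ≤ ‖∑' k, b k * w ^ k‖ := by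
  have hd : DiffContOnCl ℂ (fun z : ℂ => ∑' k, b k * z ^ k) (Metric.ball 0 1) := by
    refine ⟨Complex.differentiableOn_tsum_of_summable_norm hb (fun k => by fun_prop)
      Metric.isOpen_ball fun k z hz => norm_mul_pow_le_of_norm_le_one ?_ _ k, ?_⟩
    · exact le_of_lt (by simpa using hz)
    · rw [closure_ball _ one_ne_zero]
      exact continuousOn_tsum_mul_pow hb
  obtain ⟨w, hw, hmax⟩ := Complex.exists_mem_frontier_isMaxOn_norm Metric.isBounded_ball
    (Metric.nonempty_ball.mpr one_pos) hd
  rw [frontier_ball _ one_ne_zero] at hw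
  rw [closure_ball _ one_ne_zero] at hmax
  exact ⟨w, by simpa using hw, fun z hz => hmax (by simpa using hz)⟩

theorem norm_tsum_mul_pow_sub_one_le (hb : Summable fun k => ‖b k‖) (hb0 : b 0 = 1) {z : ℂ}
    (hz : ‖z‖ ≤ 1) : ‖∑' k, b k * z ^ k - 1‖ ≤ ∑' k, ‖b (k + 1)‖ := by
  have hs : Summable fun k => b k * z ^ k :=
    .of_norm_bounded hb fun k => norm_mul_pow_le_of_norm_le_one hz _ k
  rw [hs.tsum_eq_zero_add]
  simp only [hb0, pow_zero, mul_one, add_sub_cancel_left]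
  exact tsum_of_norm_bounded ((summable_nat_add_iff 1).mpr hb).hasSum
    fun k => norm_mul_pow_le_of_norm_le_one hz _ _

end PowerSeries

theorem Nat.Primes.norm_cpow_neg_le_one (p : Nat.Primes) {s : ℂ} (hs : 0 ≤ s.re) :
    ‖((p : ℕ) : ℂ) ^ (-s)‖ ≤ 1 := by
  rw [Complex.norm_natCast_cpow_of_pos p.2.pos]
  exact Real.rpow_le_one_of_one_le_of_nonpos (by exact_mod_cast p.2.one_le) (by simpa using hs)

theorem div_natCast_pow_cpow (c : ℂ) (p : Nat.Primes) (s : ℂ) (k : ℕ) :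
    c / (((p : ℕ) : ℂ) ^ k) ^ s = c * (((p : ℕ) : ℂ) ^ (-s)) ^ k := by
  have h : (((p : ℕ) : ℂ) ^ k) ^ s = (((p : ℕ) : ℂ) ^ s) ^ k := by
    induction k with
    | zero => simp
    | succ k ih =>
      have := Complex.natCast_mul_natCast_cpow ((p : ℕ) ^ k) p s
      push_cast at this
      rw [pow_succ, this, ih, pow_succ]
  rw [h, Complex.cpow_neg, inv_pow, div_eq_mul_inv]

/-- If `∑ |a_n|` converges then so does the double sum of `|a_{p^k}|` over primes `p` and
`k ≥ 1`. -/
theorem summable_tsum_norm_primes_pow_succ {a : ℕ → ℂ} (hsum : Summable fun n => ‖a n‖) :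
    Summable fun p : Nat.Primes => ∑' k : ℕ, ‖a ((p : ℕ) ^ (k + 1))‖ := by
  have h := (hsum.comp_injective (i := fun x : Nat.Primes × ℕ => (x.1 : ℕ) ^ (x.2 + 1)) ?_).prod
  · exact h
  · exact Subtype.val_injective.comp Nat.Primes.prodNatEquiv.injective

/-- The Euler product of the Dirichlet series of a multiplicative function. -/
theorem IsMultiplicativeFun.hasProd_tsum_mul_cpow_pow {a : ℕ → ℂ} (ha : IsMultiplicativeFun a)
    (hsum : Summable fun n => ‖a n‖) {s : ℂ} (hs : 0 ≤ s.re) :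
    HasProd (fun p : Nat.Primes => ∑' k : ℕ, a ((p : ℕ) ^ k) * (((p : ℕ) : ℂ) ^ (-s)) ^ k)
      (∑' n : ℕ, a (n + 1) / ((n : ℂ) + 1) ^ s) := by
  let f : ℕ → ℂ := fun n => if n = 0 then 0 else a n / (n : ℂ) ^ s
  have hf : Summable (‖f ·‖) := by
    refine hsum.of_nonneg_of_le (fun _ => norm_nonneg _) fun n => ?_
    rcases Nat.eq_zero_or_pos n with rfl | hn
    · simp [f]
    · simp only [f, hn.ne', if_false]
      rw [norm_div, Complex.norm_natCast_cpow_of_pos hn]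
      exact div_le_self (norm_nonneg _) (Real.one_le_rpow (by exact_mod_cast hn) hs)
  have hmul : ∀ {m n : ℕ}, m.Coprime n → f (m * n) = f m * f n := by
    intro m n hmn
    rcases Nat.eq_zero_or_pos m with rfl | hm
    · simp [f]
    rcases Nat.eq_zero_or_pos n with rfl | hn
    · simp [f]
    simp only [f, hm.ne', hn.ne', mul_eq_zero, or_self, if_false]
    rw [ha.2 m n hm hn hmn, Nat.cast_mul, Complex.natCast_mul_natCast_cpow, mul_div_mul_comm]
  have key := EulerProduct.eulerProduct_hasProd (f := f) (by simp [f, ha.1]) hmul hf (by simp [f])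
  rw [hf.of_norm.tsum_eq_zero_add] at key
  convert key using 1
  · ext p
    refine tsum_congr fun k => ?_
    simp [f, p.2.ne_zero, div_natCast_pow_cpow]
  · simp [f]

/-- A bound for a product of absolutely convergent power series in the variables `p ^ (-s)` on the
open right half-plane extends to the power series in independent unimodular variables. -/
theorem prod_norm_tsum_mul_pow_le_of_forall_cpow {b : Nat.Primes → ℕ → ℂ}
    (hb : ∀ p, Summable fun k => ‖b p k‖) (S : Finset Nat.Primes) {B : ℝ}
    (hB : ∀ s : ℂ, 0 < s.re → ∏ p ∈ S, ‖∑' k, b p k * (((p : ℕ) : ℂ) ^ (-s)) ^ k‖ ≤ B)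
    (w : Nat.Primes → ℂ) (hw : ∀ p, ‖w p‖ = 1) :
    ∏ p ∈ S, ‖∑' k, b p k * w p ^ k‖ ≤ B := by
  have hcont (p : Nat.Primes) := continuousOn_tsum_mul_pow (hb p)
  -- the bound holds on the imaginary axis
  have hline : ∀ t : ℝ, ∏ p ∈ S,
      ‖∑' k, b p k * (((p : ℕ) : ℂ) ^ (2 * Real.pi * t * Complex.I)) ^ k‖ ≤ B := by
    intro t
    let s : ℕ → ℂ := fun n => ((1 / ((n : ℝ) + 1) : ℝ) : ℂ) - 2 * Real.pi * t * Complex.I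
    have hsre : ∀ n, 0 < (s n).re := fun n => by
      simp only [s, Complex.sub_re, Complex.ofReal_re]
      simp
      positivity
    have hslim : Tendsto (fun n => -s n) atTop (𝓝 (2 * Real.pi * t * Complex.I)) := by
      have h := ((Complex.continuous_ofReal.tendsto 0).comp
        (tendsto_one_div_add_atTop_nhds_zero_nat (𝕜 := ℝ))).sub_const (2 * Real.pi * t * Complex.I)
      simpa [s, Function.comp_def] using h.neg
    refine le_of_tendsto' (x := atTop) (tendsto_finsetProd S fun p _ => ?_) fun n => hB (s n) (hsre n)
    refine ((hcont p _ ?_).tendsto.comp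
      (tendsto_nhdsWithin_iff.mpr ⟨?_, Eventually.of_forall fun n => ?_⟩)).norm
    · rw [mem_closedBall_zero_iff]
      simpa using p.norm_cpow_neg_le_one (s := -(2 * Real.pi * t * Complex.I)) (by simp)
    · exact hslim.const_cpow (Or.inl (by exact_mod_cast p.2.ne_zero))
    · rw [mem_closedBall_zero_iff]
      exact p.norm_cpow_neg_le_one (hsre n).le
  have hdense := UnitAddTorus.denseRange_line (fun p : S => Real.log (p : Nat.Primes))
    Nat.Primes.eq_zero_of_sum_mul_log_eq_zero
  have hclosed : IsClosed {x : UnitAddTorus S |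
      ∏ p : S, ‖∑' k, b p k * (fourier 1 (x p)) ^ k‖ ≤ B} := by
    refine isClosed_le (continuous_finsetProd _ fun p _ => Continuous.norm ?_) continuous_const
    exact (hcont p).comp_continuous (f := fun x : UnitAddTorus S => fourier 1 (x p))
      (by fun_prop) fun x => by
        rw [mem_closedBall_zero_iff, fourier_one, Circle.norm_coe]
  have hall := isClosed_property hdense hclosed fun t => ?_
  · have := hall fun p => ((Complex.arg (w p) / (2 * Real.pi) : ℝ) : UnitAddCircle)
    rw [← Finset.prod_coe_sort S]
    convert this using 7 with p _ k
    rw [fourier_coe_apply]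
    conv_lhs => rw [← Complex.norm_mul_exp_arg_mul_I (w p), hw]
    rw [Complex.ofReal_one, one_mul]
    congr 1
    push_cast
    field_simp
  · have := hline t
    rw [← Finset.prod_coe_sort S] at this
    convert this using 7 with p _ k
    rw [fourier_coe_apply, Complex.cpow_def_of_ne_zero (by exact_mod_cast p.1.2.ne_zero)]
    congr 1
    push_cast
    ring

theorem Nat.Primes.norm_tsum_mul_cpow_pow_le_sSup {b : ℕ → ℂ} (hb : Summable fun k => ‖b k‖)
    (p : Nat.Primes) {s : ℂ} (hs : 0 < s.re) :
    ‖∑' k, b k * (((p : ℕ) : ℂ) ^ (-s)) ^ k‖ ≤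
      sSup ((fun s : ℂ => ‖∑' k, b k * (((p : ℕ) : ℂ) ^ (-s)) ^ k‖) '' {s : ℂ | 0 < s.re}) := by
  obtain ⟨w, -, hw⟩ := exists_norm_eq_one_forall_norm_tsum_mul_pow_le hb
  refine le_csSup ⟨‖∑' k, b k * w ^ k‖, ?_⟩ ⟨s, hs, rfl⟩
  rintro _ ⟨z, hz, rfl⟩
  exact hw _ (p.norm_cpow_neg_le_one (le_of_lt hz))

theorem Nat.Primes.one_le_sSup_norm_tsum_mul_cpow_pow {b : ℕ → ℂ}
    (hb : Summable fun k => ‖b k‖) (hb0 : b 0 = 1) (p : Nat.Primes) :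
    1 ≤ sSup ((fun s : ℂ => ‖∑' k, b k * (((p : ℕ) : ℂ) ^ (-s)) ^ k‖) ''
      {s : ℂ | 0 < s.re}) := by
  have hzero : (∑' k, b k * (0 : ℂ) ^ k) = 1 := by
    rw [tsum_eq_single 0 fun k hk => by simp [hk], hb0]
    simp
  have hlim : Tendsto (fun n : ℕ => ((p : ℕ) : ℂ) ^ (-((n + 1 : ℕ) : ℂ))) atTop (𝓝 0) := by
    have h : ‖((p : ℕ) : ℂ)⁻¹‖ < 1 := by
      rw [norm_inv, Complex.norm_natCast]
      exact inv_lt_one_of_one_lt₀ (by exact_mod_cast p.2.one_lt)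
    refine ((tendsto_pow_atTop_nhds_zero_of_norm_lt_one h).comp (tendsto_add_atTop_nat 1)).congr
      fun n => ?_
    rw [Complex.cpow_neg, Complex.cpow_natCast, Function.comp_apply, inv_pow]
  have hre : ∀ n : ℕ, 0 < (((n + 1 : ℕ) : ℂ)).re := fun n => by
    rw [Complex.natCast_re]
    positivity
  have hcont := ((continuousOn_tsum_mul_pow hb) 0 (by simp)).tendsto.comp
    (tendsto_nhdsWithin_iff.mpr ⟨hlim, Eventually.of_forall fun n => by
      rw [mem_closedBall_zero_iff]
      exact p.norm_cpow_neg_le_one (hre n).le⟩)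
  rw [hzero] at hcont
  have := hcont.norm
  rw [norm_one] at this
  exact le_of_tendsto' this fun n => p.norm_tsum_mul_cpow_pow_le_sSup hb (hre n)

theorem prod_mul_two_sub_exp_le_of_hasProd {ι : Type*} {g : ι → ℂ} {x : ℂ} (hg : HasProd g x)
    {ε : ι → ℝ} (hε : Summable ε) (hgε : ∀ i, ‖g i - 1‖ ≤ ε i) (S : Finset ι) :
    (∏ i ∈ S, ‖g i‖) * (2 - Real.exp (∑' i : {i // i ∉ S}, ε i)) ≤ ‖x‖ := by
  classical
  have hε0 (i : ι) : 0 ≤ ε i := (norm_nonneg _).trans (hgε i)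
  refine ge_of_tendsto hg.norm ?_
  filter_upwards [eventually_ge_atTop S] with u hu
  have htail : ∑ i ∈ u \ S, ‖g i - 1‖ ≤ ∑' i : {i // i ∉ S}, ε i := by
    calc ∑ i ∈ u \ S, ‖g i - 1‖ ≤ ∑ i ∈ u \ S, ε i := Finset.sum_le_sum fun i _ => hgε i
      _ = ∑ i ∈ (u \ S).subtype (· ∉ S), ε i := by
        rw [Finset.sum_subtype_of_mem ε fun i hi => (Finset.mem_sdiff.mp hi).2]
      _ ≤ _ := (hε.subtype _).sum_le_tsum _ fun i _ => hε0 i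
  have hnear := Finset.norm_prod_one_add_sub_one_le (u \ S) fun i => g i - 1
  simp only [add_sub_cancel] at hnear
  have hrev : 1 - ‖∏ i ∈ u \ S, g i‖ ≤ ‖∏ i ∈ u \ S, g i - 1‖ := by
    rw [norm_sub_rev]
    simpa using norm_sub_norm_le 1 (∏ i ∈ u \ S, g i)
  have hexp := Real.exp_le_exp.mpr htail
  rw [← Finset.prod_sdiff hu, mul_comm, norm_prod] at *
  exact mul_le_mul_of_nonneg_right (by linarith) (Finset.prod_nonneg fun i _ => norm_nonneg _)

/-- For multiplicative `a` with `∑ |a_n| < ∞`, the sup norm of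
`f(s) = ∑ a_n n^{-s}` on the right half-plane factors as the (convergent) infinite
product over primes of the sup norms of the Euler factors
`f_p(s) = ∑_{k≥0} a_{p^k} p^{-ks}`. -/
theorem euler_product_norm_factorization (a : ℕ → ℂ)
    (ha : IsMultiplicativeFun a) (hsum : Summable fun n : ℕ => ‖a (n + 1)‖) :
    Multipliable (fun p : Nat.Primes =>
      sSup ((fun s : ℂ => ‖∑' k : ℕ, a ((p : ℕ) ^ k) / (((p : ℕ) : ℂ) ^ k) ^ s‖) ''
        {s : ℂ | 0 < s.re})) ∧
    sSup ((fun s : ℂ => ‖∑' n : ℕ, a (n + 1) / ((n : ℂ) + 1) ^ s‖) '' {s : ℂ | 0 < s.re}) =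
      ∏' p : Nat.Primes,
        sSup ((fun s : ℂ => ‖∑' k : ℕ, a ((p : ℕ) ^ k) / (((p : ℕ) : ℂ) ^ k) ^ s‖) ''
          {s : ℂ | 0 < s.re}) := by
  simp_rw [div_natCast_pow_cpow]
  have hsum' : Summable fun n => ‖a n‖ := (summable_nat_add_iff 1).mp hsum
  have hb (p : Nat.Primes) : Summable fun k => ‖a ((p : ℕ) ^ k)‖ :=
    hsum'.comp_injective (Nat.pow_right_injective p.2.two_le)
  have hb0 (p : Nat.Primes) : a ((p : ℕ) ^ 0) = 1 := by rw [pow_zero, ha.1]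
  set M : Nat.Primes → ℝ := fun p => sSup ((fun s : ℂ =>
    ‖∑' k : ℕ, a ((p : ℕ) ^ k) * (((p : ℕ) : ℂ) ^ (-s)) ^ k‖) '' {s : ℂ | 0 < s.re})
  set B := sSup ((fun s : ℂ => ‖∑' n : ℕ, a (n + 1) / ((n : ℂ) + 1) ^ s‖) '' {s : ℂ | 0 < s.re})
  have hne : {s : ℂ | 0 < s.re}.Nonempty := ⟨1, by simp⟩
  set ε : Nat.Primes → ℝ := fun p => ∑' k : ℕ, ‖a ((p : ℕ) ^ (k + 1))‖
  have hε : Summable ε := summable_tsum_norm_primes_pow_succ hsum'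
  have hprod {s : ℂ} (hs : 0 < s.re) := ha.hasProd_tsum_mul_cpow_pow hsum' hs.le
  have hfactor (p : Nat.Primes) {s : ℂ} (hs : 0 < s.re) :
      ‖∑' k : ℕ, a ((p : ℕ) ^ k) * (((p : ℕ) : ℂ) ^ (-s)) ^ k - 1‖ ≤ ε p :=
    norm_tsum_mul_pow_sub_one_le (hb p) (hb0 p) (p.norm_cpow_neg_le_one hs.le)
  have hMone (p : Nat.Primes) : 1 ≤ M p := p.one_le_sSup_norm_tsum_mul_cpow_pow (hb p) (hb0 p)
  have hMle (p : Nat.Primes) : M p ≤ 1 + ε p := by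
    refine csSup_le (hne.image _) ?_
    rintro _ ⟨s, hs, rfl⟩
    have := norm_sub_norm_le (∑' k : ℕ, a ((p : ℕ) ^ k) * (((p : ℕ) : ℂ) ^ (-s)) ^ k) 1
    rw [norm_one] at this
    linarith [hfactor p hs]
  have hmult : Multipliable M := by
    have : Summable fun p => M p - 1 :=
      hε.of_nonneg_of_le (fun p => sub_nonneg.mpr (hMone p)) fun p => by linarith [hMle p]
    simpa using Real.multipliable_one_add_of_summable this
  have hupper {s : ℂ} (hs : 0 < s.re) :
      ‖∑' n : ℕ, a (n + 1) / ((n : ℂ) + 1) ^ s‖ ≤ ∏' p, M p :=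
    le_of_tendsto_of_tendsto' (hprod hs).norm hmult.hasProd fun S =>
      Finset.prod_le_prod (fun _ _ => norm_nonneg _) fun p _ =>
        p.norm_tsum_mul_cpow_pow_le_sSup (hb p) hs
  have hleB {s : ℂ} (hs : 0 < s.re) : ‖∑' n : ℕ, a (n + 1) / ((n : ℂ) + 1) ^ s‖ ≤ B := by
    refine le_csSup ⟨∏' p, M p, ?_⟩ ⟨s, hs, rfl⟩
    rintro _ ⟨z, hz, rfl⟩
    exact hupper hz
  refine ⟨hmult, le_antisymm (csSup_le (hne.image _) ?_) ?_⟩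
  · rintro _ ⟨s, hs, rfl⟩
    exact hupper hs
  choose w hw hwmax using fun p => exists_norm_eq_one_forall_norm_tsum_mul_pow_le (hb p)
  have htail : Tendsto (fun S : Finset Nat.Primes =>
      2 - Real.exp (∑' p : {p // p ∉ S}, ε p)) atTop (𝓝 1) := by
    have := ((Real.continuous_exp.tendsto 0).comp (tendsto_tsum_compl_atTop_zero ε)).const_sub 2
    rw [Real.exp_zero] at this
    norm_num at this
    exact this
  have hlim := Tendsto.mul (show Tendsto (fun S => ∏ p ∈ S, M p) atTop _ from hmult.hasProd) htail
  rw [mul_one] at hlim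
  refine le_of_tendsto hlim ?_
  filter_upwards [htail.eventually_const_lt one_pos] with S hS
  rw [← le_div_iff₀ hS]
  calc ∏ p ∈ S, M p ≤ ∏ p ∈ S, ‖∑' k : ℕ, a ((p : ℕ) ^ k) * w p ^ k‖ := by
        refine Finset.prod_le_prod (fun p _ => zero_le_one.trans (hMone p)) fun p _ =>
          csSup_le (hne.image _) ?_
        rintro _ ⟨s, hs, rfl⟩
        exact hwmax p _ (p.norm_cpow_neg_le_one (le_of_lt hs))
    _ ≤ B / (2 - Real.exp (∑' p : {p // p ∉ S}, ε p)) :=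
        prod_norm_tsum_mul_pow_le_of_forall_cpow hb S (fun s hs => (le_div_iff₀ hS).mpr <|
          (prod_mul_two_sub_exp_le_of_hasProd (hprod hs) hε (fun p => hfactor p hs) S).trans
            (hleB hs)) w hw
end
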